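/- Hölder extension of biholomorphisms: Let D and D′ be bounded strictly pseudoconvex domains with C^∞ boundary in ℝ^{2n}, with respect to smooth almost complex structures J and J′ defined on neighborhoods of the closures of D and D′ respectively, and let f : D → D′ be a smooth (J,J′)-biholomorphism. Then f extends to a homeomorphism between the closures of D and D′ which is Hölder continuous with exponent 1/2, and the extension of f^{-1} is Hölder continuous with exponent 1/2 as well. -/

import Mathlib

open Complex Metric Set MeasureTheory Filter Topology Bornology ENNReal

noncomputable section

/-- We identify `ℝ^{2n}` with `ℂⁿ` (with the Euclidean norm). -/
abbrev Cn (n : ℕ) : Type := EuclideanSpace ℂ (Fin n)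

/-- The standard complex structure on `ℂⁿ ≅ ℝ^{2n}`: multiplication by `i`,
viewed as an `ℝ`-linear map. -/
def Jstd (n : ℕ) : Cn n →L[ℝ] Cn n :=
  ContinuousLinearMap.restrictScalars ℝ (Complex.I • ContinuousLinearMap.id ℂ (Cn n))

/-- The standard complex structure on `ℂ ≅ ℝ²`. -/
def JstdC : ℂ →L[ℝ] ℂ :=
  ContinuousLinearMap.restrictScalars ℝ (Complex.I • ContinuousLinearMap.id ℂ ℂ)

/-- `J` is a (smooth) almost complex structure on the set `Ω ⊆ ℂⁿ ≅ ℝ^{2n}`: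
a `C^∞` field of linear automorphisms with `J(x) ∘ J(x) = -Id`. -/
def IsACS {n : ℕ} (Ω : Set (Cn n)) (J : Cn n → Cn n →L[ℝ] Cn n) : Prop :=
  ContDiffOn ℝ (⊤ : ℕ∞) J Ω ∧ ∀ x ∈ Ω, (J x).comp (J x) = -ContinuousLinearMap.id ℝ (Cn n)

/-- The open unit disc `Δ` in `ℂ`. -/
def unitDisc : Set ℂ := Metric.ball 0 1

/-- A map between (subsets of) almost complex spaces is `(J,J')`-holomorphic on `s` if
`df_x ∘ J(x) = J'(f(x)) ∘ df_x` on `s`. -/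
def PseudoHolOn {n m : ℕ} (J : Cn n → Cn n →L[ℝ] Cn n) (J' : Cn m → Cn m →L[ℝ] Cn m)
    (f : Cn n → Cn m) (s : Set (Cn n)) : Prop :=
  ∀ x ∈ s, DifferentiableAt ℝ f x ∧
    (fderiv ℝ f x).comp (J x) = (J' (f x)).comp (fderiv ℝ f x)

/-- A map from an open subset of `ℂ` is `J`-holomorphic on `s` if
`df_ζ ∘ J_st = J(f(ζ)) ∘ df_ζ` on `s`. -/
def JHolOn {n : ℕ} (J : Cn n → Cn n →L[ℝ] Cn n) (f : ℂ → Cn n) (s : Set ℂ) : Prop :=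
  ∀ ζ ∈ s, DifferentiableAt ℝ f ζ ∧
    (fderiv ℝ f ζ).comp JstdC = (J (f ζ)).comp (fderiv ℝ f ζ)

/-- A `J`-holomorphic disc in `D`. -/
def JDisc {n : ℕ} (J : Cn n → Cn n →L[ℝ] Cn n) (D : Set (Cn n)) (f : ℂ → Cn n) : Prop :=
  MapsTo f unitDisc D ∧ JHolOn J f unitDisc

/-- The nonnegative part of an extended real number, as an element of `ℝ≥0∞`. -/
def erealPos (x : EReal) : ℝ≥0∞ := if x = ⊤ then ⊤ else ENNReal.ofReal x.toReal

/-- The integral of an `EReal`-valued function: the (unsigned) integral of the positive part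
minus the integral of the negative part. -/
def erealIntegral {X : Type} [MeasurableSpace X] (μ : Measure X) (g : X → EReal) : EReal :=
  ((∫⁻ x, erealPos (g x) ∂μ : ℝ≥0∞) : EReal) - ((∫⁻ x, erealPos (-(g x)) ∂μ : ℝ≥0∞) : EReal)

/-- `h : ℂ → [-∞,∞)` is subharmonic on `s`: upper semicontinuous and satisfying the
sub-mean-value inequality `h(a) ≤ (2π)⁻¹ ∫₀^{2π} h(a + r e^{iθ}) dθ` whenever the closed disc
of center `a` and radius `r` is contained in `s`. -/
def SubharmonicOnE (h : ℂ → EReal) (s : Set ℂ) : Prop :=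
  UpperSemicontinuousOn h s ∧
  ∀ a : ℂ, ∀ r : ℝ, 0 < r → Metric.closedBall a r ⊆ s →
    h a ≤ (((2 * Real.pi)⁻¹ : ℝ) : EReal) *
      erealIntegral (volume.restrict (Set.Ioc (0 : ℝ) (2 * Real.pi)))
        (fun θ : ℝ => h (a + (r : ℂ) * Complex.exp ((θ : ℂ) * Complex.I)))

/-- `u : Ω → [-∞,∞)` is `J`-plurisubharmonic on `Ω`: upper semicontinuous, and `u ∘ f` is
subharmonic on `Δ` for every `J`-holomorphic disc `f : Δ → Ω`. -/
def JPshOn {n : ℕ} (J : Cn n → Cn n →L[ℝ] Cn n) (Ω : Set (Cn n)) (u : Cn n → EReal) : Prop :=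
  UpperSemicontinuousOn u Ω ∧
  ∀ f : ℂ → Cn n, JDisc J Ω f → SubharmonicOnE (fun ζ => u (f ζ)) unitDisc

/-- Real-valued `J`-plurisubharmonic functions. -/
def JPshOnR {n : ℕ} (J : Cn n → Cn n →L[ℝ] Cn n) (Ω : Set (Cn n)) (u : Cn n → ℝ) : Prop :=
  JPshOn J Ω (fun x => (u x : EReal))

/-- The `1`-form `J*dr : w ↦ dr_x(J(x)w)`. -/
def JStarDr {n : ℕ} (J : Cn n → Cn n →L[ℝ] Cn n) (r : Cn n → ℝ) (x : Cn n) : Cn n →L[ℝ] ℝ :=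
  (fderiv ℝ r x).comp (J x)

/-- The Levi form of a `C²` function `r`:
`L^J_r(p,v) = -d(J*dr)_p(v, J(p)v)` where `dα_p(u,w) = (∂_u α)_p(w) - (∂_w α)_p(u)`. -/
def LeviForm {n : ℕ} (J : Cn n → Cn n →L[ℝ] Cn n) (r : Cn n → ℝ) (p v : Cn n) : ℝ :=
  -((fderiv ℝ (JStarDr J r) p v) (J p v) - (fderiv ℝ (JStarDr J r) p (J p v)) v)

/-- `r` is strictly `J`-plurisubharmonic on `S`: its Levi form is positive definite there. -/
def StrictJPshOn {n : ℕ} (J : Cn n → Cn n →L[ℝ] Cn n) (r : Cn n → ℝ) (S : Set (Cn n)) : Prop :=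
  ∀ p ∈ S, ∀ v : Cn n, v ≠ 0 → 0 < LeviForm J r p v

/-- The Kobayashi–Royden infinitesimal pseudometric of `(D,J)`:
`K(p,v) = inf {α > 0 : ∃ J-holomorphic disc f : Δ → D, f(0) = p, df_0(∂/∂x) = v/α}`. -/
def kobMetric {n : ℕ} (J : Cn n → Cn n →L[ℝ] Cn n) (D : Set (Cn n)) (p v : Cn n) : ℝ :=
  sInf {α : ℝ | 0 < α ∧ ∃ f : ℂ → Cn n, JDisc J D f ∧ f 0 = p ∧ fderiv ℝ f 0 1 = α⁻¹ • v}

/-- A piecewise `C¹` path `γ : [0,1] → ℝ^{2n}`. -/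
def PiecewiseC1On {n : ℕ} (γ : ℝ → Cn n) : Prop :=
  ContinuousOn γ (Set.Icc 0 1) ∧
  ∃ (m : ℕ) (t : ℕ → ℝ), t 0 = 0 ∧ t m = 1 ∧ (∀ i < m, t i < t (i + 1)) ∧
    ∀ i < m, ContDiffOn ℝ 1 γ (Set.Icc (t i) (t (i + 1)))

/-- The (integrated) Kobayashi pseudodistance of `(D,J)`: the infimum of the Kobayashi–Royden
lengths of piecewise `C¹` paths in `D` joining `p` to `q`. -/
def kobDist {n : ℕ} (J : Cn n → Cn n →L[ℝ] Cn n) (D : Set (Cn n)) (p q : Cn n) : ℝ :=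
  sInf {L : ℝ | ∃ γ : ℝ → Cn n, PiecewiseC1On γ ∧ MapsTo γ (Set.Icc 0 1) D ∧
    γ 0 = p ∧ γ 1 = q ∧ L = ∫ t in (0 : ℝ)..1, kobMetric J D (γ t) (deriv γ t)}

/-- The cluster set of `f` (defined on `S`) along `A ⊆ closure S`: all limits of sequences
`f(s_k)` where `s_k ∈ S` converges to a point of `A`. -/
def clusterSet {X Y : Type*} [TopologicalSpace X] [TopologicalSpace Y]
    (f : X → Y) (S A : Set X) : Set Y :=
  {y | ∃ u : ℕ → X, (∀ k, u k ∈ S) ∧ (∃ a ∈ A, Tendsto u atTop (𝓝 a)) ∧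
    Tendsto (fun k => f (u k)) atTop (𝓝 y)}

/-- `N` is a `d`-dimensional `C^∞` submanifold of `ℂⁿ ≅ ℝ^{2n}`: near every point it can be
straightened, by a `C^∞` diffeomorphism onto an open subset of `ℝ^{2n}`, to the coordinate
subspace spanned by the first `d` coordinates. -/
def IsSmoothSubmanifold {n : ℕ} (d : ℕ) (N : Set (Cn n)) : Prop :=
  ∀ p ∈ N, ∃ (U : Set (Cn n)) (V : Set (EuclideanSpace ℝ (Fin (2 * n))))
    (φ : Cn n → EuclideanSpace ℝ (Fin (2 * n))) (ψ : EuclideanSpace ℝ (Fin (2 * n)) → Cn n),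
    IsOpen U ∧ p ∈ U ∧ IsOpen V ∧ ContDiffOn ℝ (⊤ : ℕ∞) φ U ∧ ContDiffOn ℝ (⊤ : ℕ∞) ψ V ∧
    (∀ x ∈ U, ψ (φ x) = x) ∧ (∀ y ∈ V, φ (ψ y) = y) ∧ MapsTo φ U V ∧
    φ '' (N ∩ U) = V ∩ {x | ∀ i : Fin (2 * n), d ≤ (i : ℕ) → x i = 0}

/-- The tangent set of `N ⊆ ℂⁿ` at `p`: velocities at `0` of differentiable curves through `p`
staying in `N` near time `0`. For a `C^∞` submanifold this is the tangent space `T_pN`. -/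
def TangentSet {n : ℕ} (N : Set (Cn n)) (p : Cn n) : Set (Cn n) :=
  {v | ∃ γ : ℝ → Cn n, γ 0 = p ∧ (∀ᶠ t in 𝓝 (0 : ℝ), γ t ∈ N) ∧
    DifferentiableAt ℝ γ 0 ∧ deriv γ 0 = v}

/-- `N` is totally real for `J`: `T_pN ∩ J(p)(T_pN) = {0}` at every `p ∈ N`. -/
def TotallyReal {n : ℕ} (J : Cn n → Cn n →L[ℝ] Cn n) (N : Set (Cn n)) : Prop :=
  ∀ p ∈ N, ∀ v ∈ TangentSet N p, J p v ∈ TangentSet N p → v = 0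

/-- `ρ` is a (global) `C^∞` defining function of `D`, defined on the neighborhood `Ω` of the
closure of `D`, with nonvanishing differential on `∂D`.  (This encodes that `D` has
`C^∞` boundary.) -/
def DefiningFunction {n : ℕ} (D Ω : Set (Cn n)) (ρ : Cn n → ℝ) : Prop :=
  IsOpen Ω ∧ closure D ⊆ Ω ∧ ContDiffOn ℝ (⊤ : ℕ∞) ρ Ω ∧
  D = {x ∈ Ω | ρ x < 0} ∧ ∀ x ∈ frontier D, fderiv ℝ ρ x ≠ 0

/-- `D` is a bounded strictly `J`-pseudoconvex domain with `C^∞` boundary: it admits a smooth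
defining function which is `J`-plurisubharmonic on `D` and strictly `J`-plurisubharmonic on a
neighborhood of `∂D`. -/
def StrictlyPseudoconvexDomain {n : ℕ} (J : Cn n → Cn n →L[ℝ] Cn n) (D : Set (Cn n)) : Prop :=
  IsOpen D ∧ IsConnected D ∧ IsBounded D ∧
  ∃ (Ω : Set (Cn n)) (ρ : Cn n → ℝ), DefiningFunction D Ω ρ ∧
    JPshOnR J D ρ ∧ ∃ W : Set (Cn n), IsOpen W ∧ frontier D ⊆ W ∧ StrictJPshOn J ρ W

end

section LeviCalculus

variable {E : Type*} [NormedAddCommGroup E] [NormedSpace ℝ E]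

/-- The one-form `J*dr` on a general normed space. -/
noncomputable def jd (J : E → E →L[ℝ] E) (r : E → ℝ) (x : E) : E →L[ℝ] ℝ :=
  (fderiv ℝ r x).comp (J x)

/-- The Levi form on a general normed space. -/
noncomputable def lev (J : E → E →L[ℝ] E) (r : E → ℝ) (p v : E) : ℝ :=
  -((fderiv ℝ (jd J r) p v) (J p v) - (fderiv ℝ (jd J r) p (J p v)) v)

theorem jd_hasFDerivAt {J : E → E →L[ℝ] E} {r : E → ℝ} {p : E}
    (hr : ContDiffAt ℝ 2 r p) (hJ : DifferentiableAt ℝ J p) :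
    HasFDerivAt (jd J r) (((ContinuousLinearMap.compL ℝ E E ℝ) (fderiv ℝ r p)).comp (fderiv ℝ J p)
      + ((ContinuousLinearMap.compL ℝ E E ℝ).flip (J p)).comp (fderiv ℝ (fderiv ℝ r) p)) p := by
  have h1 : HasFDerivAt (fderiv ℝ r) (fderiv ℝ (fderiv ℝ r) p) p :=
    ((hr.fderiv_right (m := 1) (by norm_num)).differentiableAt (by norm_num)).hasFDerivAt
  exact h1.clm_comp hJ.hasFDerivAt

theorem jd_differentiableAt {J : E → E →L[ℝ] E} {r : E → ℝ} {p : E}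
    (hr : ContDiffAt ℝ 2 r p) (hJ : DifferentiableAt ℝ J p) : DifferentiableAt ℝ (jd J r) p :=
  (jd_hasFDerivAt hr hJ).differentiableAt

theorem lev_formula {J : E → E →L[ℝ] E} {r : E → ℝ} {p : E}
    (hr : ContDiffAt ℝ 2 r p) (hJ : DifferentiableAt ℝ J p) (hJ2 : ∀ v, J p (J p v) = -v) (v : E) :
    lev J r p v = fderiv ℝ (fderiv ℝ r) p v v + fderiv ℝ (fderiv ℝ r) p (J p v) (J p v)
      + fderiv ℝ r p (fderiv ℝ J p (J p v) v - fderiv ℝ J p v (J p v)) := by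
  unfold lev
  rw [(jd_hasFDerivAt hr hJ).fderiv]
  simp [hJ2]
  ring

theorem eventually_diff {r : E → ℝ} {p : E} (hr : ContDiffAt ℝ 2 r p) :
    ∀ᶠ x in 𝓝 p, DifferentiableAt ℝ r x := by
  filter_upwards [(hr.of_le (m := 1) (by norm_num)).eventually (by simp)] with x hx
  exact hx.differentiableAt (by norm_num)

theorem lev_comb {J : E → E →L[ℝ] E} {r s : E → ℝ} {p : E}
    (hr : ContDiffAt ℝ 2 r p) (hs : ContDiffAt ℝ 2 s p) (hJ : DifferentiableAt ℝ J p)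
    (a : ℝ) (v : E) :
    lev J (fun x => r x + a * s x) p v = lev J r p v + a * lev J s p v := by
  have h : jd J (fun x => r x + a * s x) =ᶠ[𝓝 p] fun x => jd J r x + a • jd J s x := by
    filter_upwards [eventually_diff hr, eventually_diff hs] with x h1 h2
    unfold jd
    rw [fderiv_fun_add h1 (h2.const_mul a), fderiv_const_mul h2]
    ext w; simp
  have h2 : HasFDerivAt (jd J (fun x => r x + a * s x))
      (fderiv ℝ (jd J r) p + a • fderiv ℝ (jd J s) p) p :=
    HasFDerivAt.congr_of_eventuallyEq ((jd_differentiableAt hr hJ).hasFDerivAt.add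
      ((jd_differentiableAt hs hJ).hasFDerivAt.const_smul a)) h
  unfold lev
  rw [h2.fderiv]
  simp
  ring

theorem lev_chi {J : E → E →L[ℝ] E} {r : E → ℝ} {p : E} {χ χ1 : ℝ → ℝ} {χ2 : ℝ}
    (hr : ContDiffAt ℝ 2 r p) (hJ : DifferentiableAt ℝ J p) (hJ2 : ∀ v, J p (J p v) = -v)
    (h1 : ∀ᶠ t in 𝓝 (r p), HasDerivAt χ (χ1 t) t) (h2 : HasDerivAt χ1 χ2 (r p)) (v : E) :
    lev J (fun x => χ (r x)) p v =
      χ1 (r p) * lev J r p v + χ2 * ((fderiv ℝ r p v) ^ 2 + (fderiv ℝ r p (J p v)) ^ 2) := by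
  have hc : ContinuousAt r p := hr.continuousAt
  have h : jd J (fun x => χ (r x)) =ᶠ[𝓝 p] fun x => χ1 (r x) • jd J r x := by
    filter_upwards [eventually_diff hr, hc.eventually h1] with x hx1 hx2
    have : HasFDerivAt (fun x => χ (r x)) (χ1 (r x) • fderiv ℝ r x) x :=
      hx2.comp_hasFDerivAt x hx1.hasFDerivAt
    unfold jd
    rw [this.fderiv]
    ext w; simp
  have h4 : HasFDerivAt (fun x => χ1 (r x)) (χ2 • fderiv ℝ r p) p :=
    h2.comp_hasFDerivAt p (hr.differentiableAt (by norm_num)).hasFDerivAt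
  have h3 := HasFDerivAt.congr_of_eventuallyEq
    (h4.smul (jd_differentiableAt hr hJ).hasFDerivAt) h
  unfold lev
  rw [h3.fderiv]
  simp [jd, hJ2]
  ring

theorem second_deriv_nonpos {h : E → ℝ} {p : E} (hh : ContDiffAt ℝ 2 h p)
    (hm : IsLocalMax h p) (v : E) : fderiv ℝ (fderiv ℝ h) p v v ≤ 0 := by
  by_contra hpos
  push Not at hpos
  set g : ℝ → ℝ := fun t => h (p + t • v) with hg
  have hline : ∀ t : ℝ, HasDerivAt (fun t : ℝ => p + t • v) v t := fun t => by
    simpa using ((hasDerivAt_id t).smul_const v).const_add p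
  have hcl : ContinuousAt (fun t : ℝ => p + t • v) 0 := (hline 0).continuousAt
  have htd : Tendsto (fun t : ℝ => p + t • v) (𝓝 0) (𝓝 p) := by
    have := hcl.tendsto; simpa using this
  have hd1 : ∀ᶠ t in 𝓝 (0 : ℝ), HasDerivAt g (fderiv ℝ h (p + t • v) v) t := by
    filter_upwards [htd.eventually (eventually_diff hh)] with t ht
    exact ht.hasFDerivAt.comp_hasDerivAt t (hline t)
  have hd1' : deriv g =ᶠ[𝓝 0] fun t => fderiv ℝ h (p + t • v) v := by
    filter_upwards [hd1] with t ht using ht.deriv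
  have hD2 : HasFDerivAt (fderiv ℝ h) (fderiv ℝ (fderiv ℝ h) p) p :=
    ((hh.fderiv_right (m := 1) (by norm_num)).differentiableAt (by norm_num)).hasFDerivAt
  have hd2 : HasDerivAt (fun t : ℝ => fderiv ℝ h (p + t • v) v)
      (fderiv ℝ (fderiv ℝ h) p v v) 0 := by
    have hD2' : HasFDerivAt (fderiv ℝ h) (fderiv ℝ (fderiv ℝ h) p) (p + (0 : ℝ) • v) := by
      simpa using hD2
    have := hD2'.comp_hasDerivAt (0 : ℝ) (hline 0)
    have h3 := this.clm_apply (hasDerivAt_const (0 : ℝ) v)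
    simpa using h3
  have hdd : deriv (deriv g) 0 = fderiv ℝ (fderiv ℝ h) p v v := by
    rw [hd1'.deriv_eq, hd2.deriv]
  have hgm : IsLocalMax g 0 := by
    have : ∀ᶠ t in 𝓝 (0 : ℝ), h (p + t • v) ≤ h p := htd.eventually hm
    filter_upwards [this] with t ht
    simpa [hg] using ht
  have hg0 : deriv g 0 = 0 := hgm.deriv_eq_zero
  have hgmin : IsLocalMin g 0 :=
    isLocalMin_of_deriv_deriv_pos (by rw [hdd]; exact hpos) hg0 hd1.self_of_nhds.continuousAt
  have hconst : g =ᶠ[𝓝 0] fun _ => g 0 := by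
    filter_upwards [hgm, hgmin] with t h1 h2 using le_antisymm h1 h2
  have : deriv g =ᶠ[𝓝 0] fun _ => 0 := by
    have := hconst.deriv
    simpa using this
  have h0 : deriv (deriv g) 0 = 0 := by rw [this.deriv_eq]; simp
  rw [hdd] at h0
  linarith

theorem lev_max {J : E → E →L[ℝ] E} {h : E → ℝ} {p : E} (hh : ContDiffAt ℝ 2 h p)
    (hJ : DifferentiableAt ℝ J p) (hJ2 : ∀ v, J p (J p v) = -v)
    (hm : IsLocalMax h p) (v : E) : lev J h p v ≤ 0 := by
  rw [lev_formula hh hJ hJ2, hm.fderiv_eq_zero]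
  have h1 := second_deriv_nonpos hh hm v
  have h2 := second_deriv_nonpos hh hm (J p v)
  simp
  linarith

theorem lev_pullback {J J' : E → E →L[ℝ] E} {u : E → ℝ} {f : E → E} {p : E}
    (hu : ContDiffAt ℝ 2 u (f p)) (hf : ContDiffAt ℝ 2 f p)
    (hJ' : DifferentiableAt ℝ J' (f p))
    (hol : ∀ᶠ x in 𝓝 p, (fderiv ℝ f x).comp (J x) = (J' (f x)).comp (fderiv ℝ f x)) (v : E) :
    lev J (fun x => u (f x)) p v = lev J' u (f p) (fderiv ℝ f p v) := by
  have hfd : ∀ᶠ x in 𝓝 p, DifferentiableAt ℝ f x := by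
    filter_upwards [(hf.of_le (m := 1) (by norm_num)).eventually (by simp)] with x hx
    exact hx.differentiableAt (by norm_num)
  have h : jd J (fun x => u (f x)) =ᶠ[𝓝 p] fun x => (jd J' u (f x)).comp (fderiv ℝ f x) := by
    filter_upwards [hfd, hol, hf.continuousAt.eventually (eventually_diff hu)] with x h1 h2 h3
    have : HasFDerivAt (fun x => u (f x)) ((fderiv ℝ u (f x)).comp (fderiv ℝ f x)) x :=
      h3.hasFDerivAt.comp x h1.hasFDerivAt
    unfold jd
    rw [this.fderiv, ContinuousLinearMap.comp_assoc, h2, ContinuousLinearMap.comp_assoc]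
  have hD2 : HasFDerivAt (fderiv ℝ f) (fderiv ℝ (fderiv ℝ f) p) p :=
    ((hf.fderiv_right (m := 1) (by norm_num)).differentiableAt (by norm_num)).hasFDerivAt
  have hjd : HasFDerivAt (fun x => jd J' u (f x))
      ((fderiv ℝ (jd J' u) (f p)).comp (fderiv ℝ f p)) p :=
    (jd_differentiableAt hu hJ').hasFDerivAt.comp p hfd.self_of_nhds.hasFDerivAt
  have h3 := HasFDerivAt.congr_of_eventuallyEq (hjd.clm_comp hD2) h
  have hsym : IsSymmSndFDerivAt ℝ f p := hf.isSymmSndFDerivAt (by simp)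
  have hh : fderiv ℝ f p (J p v) = J' (f p) (fderiv ℝ f p v) := by
    have := hol.self_of_nhds
    exact congrArg (fun L => L v) this
  unfold lev
  rw [h3.fderiv]
  simp [hh, hsym.eq (J p v) v]

end LeviCalculus

section Quadratic

variable {E : Type*} [NormedAddCommGroup E] [NormedSpace ℝ E]

/-- The squared distance to `p` for the bilinear form `β`. -/
noncomputable def qn (β : E →L[ℝ] E →L[ℝ] ℝ) (p z : E) : ℝ := β (z - p) (z - p)

/-- An inner product adapted to a linear complex structure `Jp`. -/
structure Adapted (β : E →L[ℝ] E →L[ℝ] ℝ) (Jp : E →L[ℝ] E) (B : ℝ) : Prop where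
  one_le : 1 ≤ B
  symm : ∀ u v, β u v = β v u
  lower : ∀ v, ‖v‖ ^ 2 ≤ β v v
  upper : ∀ u v, |β u v| ≤ B * ‖u‖ * ‖v‖
  sq : ∀ v, Jp (Jp v) = -v
  inv : ∀ u v, β (Jp u) (Jp v) = β u v

theorem qn_hasFDerivAt (β : E →L[ℝ] E →L[ℝ] ℝ) (hs : ∀ u v, β u v = β v u) (p z : E) :
    HasFDerivAt (qn β p) (2 • β (z - p)) z := by
  have h1 : HasFDerivAt (fun z : E => z - p) (ContinuousLinearMap.id ℝ E) z :=
    (hasFDerivAt_id z).sub_const p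
  have h2 : HasFDerivAt (fun z : E => β (z - p)) β z :=
    β.hasFDerivAt.comp z h1
  have h3 := h2.clm_apply h1
  refine h3.congr_fderiv ?_
  ext w
  have := hs w (z - p)
  simp only [ContinuousLinearMap.comp_id, add_apply,
    ContinuousLinearMap.flip_apply, smul_apply, this]
  simp
  ring

theorem qn_contDiff (β : E →L[ℝ] E →L[ℝ] ℝ) (p : E) {k : WithTop ℕ∞} : ContDiff ℝ k (qn β p) := by
  unfold qn
  fun_prop

theorem qn_fderiv2 (β : E →L[ℝ] E →L[ℝ] ℝ) (hs : ∀ u v, β u v = β v u) (p z u v : E) :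
    fderiv ℝ (fderiv ℝ (qn β p)) z u v = 2 * β u v := by
  have h : fderiv ℝ (qn β p) = fun z => 2 • β (z - p) := by
    funext z; exact (qn_hasFDerivAt β hs p z).fderiv
  have h1 : HasFDerivAt (fun z : E => z - p) (ContinuousLinearMap.id ℝ E) z :=
    (hasFDerivAt_id z).sub_const p
  have h2 : HasFDerivAt (fun z : E => β (z - p)) β z :=
    β.hasFDerivAt.comp z h1
  have h3 : HasFDerivAt (fun z : E => (2 : ℕ) • β (z - p)) ((2 : ℕ) • β) z := h2.const_smul 2
  rw [h, h3.fderiv]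
  simp

theorem Adapted.bessel {β : E →L[ℝ] E →L[ℝ] ℝ} {Jp : E →L[ℝ] E} {B : ℝ} (h : Adapted β Jp B)
    (ζ v : E) : (β ζ v) ^ 2 + (β ζ (Jp v)) ^ 2 ≤ β ζ ζ * β v v := by
  have horth : β v (Jp v) = 0 := by
    have h1 := h.inv v (Jp v)
    rw [h.sq, map_neg, h.symm (Jp v) v] at h1
    linarith
  have horth' : β (Jp v) v = 0 := by rw [h.symm, horth]
  have hvv : β (Jp v) (Jp v) = β v v := h.inv v v
  by_cases hv : v = 0
  · simp [hv]
  have hpos : 0 < β v v := lt_of_lt_of_le (by positivity) (h.lower v)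
  set a := β ζ v with ha
  set b := β ζ (Jp v) with hb
  have ha' : β v ζ = a := by rw [h.symm]
  have hb' : β (Jp v) ζ = b := by rw [h.symm]
  have key : 0 ≤ β (β v v • ζ - a • v - b • Jp v) (β v v • ζ - a • v - b • Jp v) :=
    le_trans (by positivity) (h.lower _)
  simp only [map_sub, map_smul, sub_apply, smul_apply,
    smul_eq_mul, ha', hb', ← ha, ← hb, horth, horth', hvv] at key
  have : 0 ≤ β v v * (β v v * β ζ ζ - a ^ 2 - b ^ 2) * 1 := by nlinarith
  have := nonneg_of_mul_nonneg_right (by simpa using this) hpos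
  nlinarith

/-- Pointwise control of `J` at `z` relative to `p`. -/
structure Ctl (J : E → E →L[ℝ] E) (C : ℝ) (p z : E) : Prop where
  one_le : 1 ≤ C
  diff : DifferentiableAt ℝ J z
  sq : ∀ v, J z (J z v) = -v
  nz : ‖J z‖ ≤ C
  np : ‖J p‖ ≤ C
  nd : ‖fderiv ℝ J z‖ ≤ C
  lip : ‖J z - J p‖ ≤ C * ‖z - p‖

theorem quad_lev {J : E → E →L[ℝ] E} {β : E →L[ℝ] E →L[ℝ] ℝ} {p z : E} {B C : ℝ}
    (h : Adapted β (J p) B) (hc : Ctl J C p z) (v : E) :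
    |lev J (qn β p) z v - 4 * β v v| ≤ (8 * B ^ 2 * C ^ 2) * ‖z - p‖ * ‖v‖ ^ 2 := by
  have hB := h.one_le
  have hC := hc.one_le
  rw [lev_formula (qn_contDiff β p).contDiffAt hc.diff hc.sq, qn_fderiv2 β h.symm,
    qn_fderiv2 β h.symm, (qn_hasFDerivAt β h.symm p z).fderiv]
  set s := ‖z - p‖
  have hs : 0 ≤ s := norm_nonneg _
  have hn : 0 ≤ ‖v‖ := norm_nonneg _
  have hJv : ‖J z v‖ ≤ C * ‖v‖ := (J z).le_of_opNorm_le hc.nz v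
  have hJpv : ‖J p v‖ ≤ C * ‖v‖ := (J p).le_of_opNorm_le hc.np v
  have hEv : ‖J z v - J p v‖ ≤ C * s * ‖v‖ := by
    have := (J z - J p).le_of_opNorm_le hc.lip v
    simpa using this
  have hd1 : ‖fderiv ℝ J z (J z v) v‖ ≤ C ^ 2 * ‖v‖ ^ 2 := by
    have h1 := (fderiv ℝ J z (J z v)).le_of_opNorm_le
      (((fderiv ℝ J z).le_of_opNorm_le hc.nd (J z v)).trans
        (mul_le_mul_of_nonneg_left hJv (by linarith))) v
    calc _ ≤ _ := h1
      _ = _ := by ring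
  have hd2 : ‖fderiv ℝ J z v (J z v)‖ ≤ C ^ 2 * ‖v‖ ^ 2 := by
    have h1 := (fderiv ℝ J z v).le_of_opNorm_le
      ((fderiv ℝ J z).le_of_opNorm_le hc.nd v) (J z v)
    calc _ ≤ _ := h1
      _ ≤ C * ‖v‖ * (C * ‖v‖) := by gcongr
      _ = _ := by ring
  have hd : ‖fderiv ℝ J z (J z v) v - fderiv ℝ J z v (J z v)‖ ≤ 2 * C ^ 2 * ‖v‖ ^ 2 := by
    refine (norm_sub_le _ _).trans ?_
    linarith
  have e1 : |β (z - p) (fderiv ℝ J z (J z v) v - fderiv ℝ J z v (J z v))|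
      ≤ B * s * (2 * C ^ 2 * ‖v‖ ^ 2) := (h.upper _ _).trans (by gcongr)
  have e2 : |β (J z v - J p v) (J z v)| ≤ B * (C * s * ‖v‖) * (C * ‖v‖) :=
    (h.upper _ _).trans (by gcongr)
  have e3 : |β (J p v) (J z v - J p v)| ≤ B * (C * ‖v‖) * (C * s * ‖v‖) :=
    (h.upper _ _).trans (by gcongr)
  have e4 : β (J z v) (J z v) - β v v = β (J z v - J p v) (J z v) + β (J p v) (J z v - J p v) := by
    rw [← h.inv v v]; simp
  have e5 : (2 * β v v + 2 * β (J z v) (J z v) + (2 • β (z - p)) (fderiv ℝ J z (J z v) v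
      - fderiv ℝ J z v (J z v))) - 4 * β v v = 2 * (β (J z v - J p v) (J z v))
      + 2 * (β (J p v) (J z v - J p v))
      + 2 * β (z - p) (fderiv ℝ J z (J z v) v - fderiv ℝ J z v (J z v)) := by
    have : (2 • β (z - p)) (fderiv ℝ J z (J z v) v
      - fderiv ℝ J z v (J z v)) = 2 * β (z - p) (fderiv ℝ J z (J z v) v
      - fderiv ℝ J z v (J z v)) := by simp
    rw [this]; linarith
  rw [e5]
  have hfin : 8 * B * C ^ 2 * s * ‖v‖ ^ 2 ≤ 8 * B ^ 2 * C ^ 2 * s * ‖v‖ ^ 2 := by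
    have : B ≤ B ^ 2 := by nlinarith
    gcongr
  rw [abs_le] at e1 e2 e3 ⊢
  constructor <;> nlinarith [e1.1, e1.2, e2.1, e2.2, e3.1, e3.2]

theorem quad_grad {J : E → E →L[ℝ] E} {β : E →L[ℝ] E →L[ℝ] ℝ} {p z : E} {B C : ℝ}
    (h : Adapted β (J p) B) (hc : Ctl J C p z) (v : E) :
    (fderiv ℝ (qn β p) z v) ^ 2 + (fderiv ℝ (qn β p) z (J z v)) ^ 2
      ≤ 4 * qn β p z * β v v + (8 * B ^ 2 * C ^ 2) * ‖z - p‖ ^ 3 * ‖v‖ ^ 2 := by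
  have hB := h.one_le
  have hC := hc.one_le
  rw [(qn_hasFDerivAt β h.symm p z).fderiv]
  have hbes := h.bessel (z - p) v
  set s := ‖z - p‖
  have hs : 0 ≤ s := norm_nonneg _
  have hn : 0 ≤ ‖v‖ := norm_nonneg _
  have hJv : ‖J z v‖ ≤ C * ‖v‖ := (J z).le_of_opNorm_le hc.nz v
  have hJpv : ‖J p v‖ ≤ C * ‖v‖ := (J p).le_of_opNorm_le hc.np v
  have hEv : ‖J z v - J p v‖ ≤ C * s * ‖v‖ := by
    have := (J z - J p).le_of_opNorm_le hc.lip v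
    simpa using this
  have hS : ‖J z v + J p v‖ ≤ 2 * C * ‖v‖ := (norm_add_le _ _).trans (by linarith)
  have e1 : |β (z - p) (J z v - J p v)| ≤ B * s * (C * s * ‖v‖) :=
    (h.upper _ _).trans (by gcongr)
  have e2 : |β (z - p) (J z v + J p v)| ≤ B * s * (2 * C * ‖v‖) :=
    (h.upper _ _).trans (by gcongr)
  have e3 : (β (z - p) (J z v)) ^ 2 - (β (z - p) (J p v)) ^ 2
      ≤ (B * s * (C * s * ‖v‖)) * (B * s * (2 * C * ‖v‖)) := by
    have : (β (z - p) (J z v)) ^ 2 - (β (z - p) (J p v)) ^ 2 =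
        β (z - p) (J z v - J p v) * β (z - p) (J z v + J p v) := by
      simp only [map_sub, map_add]; ring
    rw [this]
    calc _ ≤ |β (z - p) (J z v - J p v) * β (z - p) (J z v + J p v)| := le_abs_self _
      _ = |β (z - p) (J z v - J p v)| * |β (z - p) (J z v + J p v)| := abs_mul _ _
      _ ≤ _ := mul_le_mul e1 e2 (abs_nonneg _) (by positivity)
  have t1 : ∀ w, (2 • β (z - p)) w = 2 * β (z - p) w := fun w => by simp
  rw [t1, t1]
  unfold qn
  nlinarith

theorem qn_lower {J : E → E →L[ℝ] E} {β : E →L[ℝ] E →L[ℝ] ℝ} {p : E} {B : ℝ}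
    (h : Adapted β (J p) B) (z : E) : ‖z - p‖ ^ 2 ≤ qn β p z := h.lower _

theorem qn_upper {J : E → E →L[ℝ] E} {β : E →L[ℝ] E →L[ℝ] ℝ} {p : E} {B : ℝ}
    (h : Adapted β (J p) B) (z : E) : qn β p z ≤ B * ‖z - p‖ ^ 2 := by
  have := (le_abs_self _).trans (h.upper (z - p) (z - p))
  unfold qn; linarith [sq (‖z - p‖)]

end Quadratic

section RealIneq

theorem real_log_lower {t s n b k L Q : ℝ} (hs : 0 < s) (hn : 0 ≤ n) (hk : 0 ≤ k)
    (hst : s ^ 2 ≤ t) (hL : |L - 4 * b| ≤ k * s * n) (hQ : Q ≤ 4 * t * b + k * s ^ 3 * n) :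
    -(2 * k * n / s) ≤ L / t - Q / t ^ 2 := by
  have ht : 0 < t := lt_of_lt_of_le (by positivity) hst
  have h1 : 4 * b - k * s * n ≤ L := by linarith [(abs_le.1 hL).1]
  have h2 : (4 * b - k * s * n) / t ≤ L / t := by gcongr
  have h3 : Q / t ^ 2 ≤ (4 * t * b + k * s ^ 3 * n) / t ^ 2 := by gcongr
  have h4 : (4 * b - k * s * n) / t - (4 * t * b + k * s ^ 3 * n) / t ^ 2
      = -(k * s * n / t) - k * s ^ 3 * n / t ^ 2 := by field_simp; ring
  have h5 : k * s * n / t ≤ k * n / s := by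
    rw [div_le_div_iff₀ ht hs]
    have : k * n * s ^ 2 ≤ k * n * t := by gcongr
    linarith
  have h6 : k * s ^ 3 * n / t ^ 2 ≤ k * n / s := by
    rw [div_le_div_iff₀ (by positivity) hs]
    have : k * n * (s ^ 2) ^ 2 ≤ k * n * t ^ 2 := by gcongr
    linarith
  have h7 : 2 * k * n / s = k * n / s + k * n / s := by ring
  linarith

theorem real_sqrt_lower {t σ s n b k L Q : ℝ} (hs : 0 < s) (hn : 0 ≤ n) (hk : 0 ≤ k)
    (hσ : 0 < σ) (hσt : σ ^ 2 = t)
    (hst : s ^ 2 ≤ t) (hL : |L - 4 * b| ≤ k * s * n) (hQ : Q ≤ 4 * t * b + k * s ^ 3 * n) :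
    b / σ - k * n ≤ L / (2 * σ) - Q / (4 * t * σ) := by
  have ht : 0 < t := lt_of_lt_of_le (by positivity) hst
  have hsσ : s ≤ σ := by
    rw [← hσt] at hst; exact (pow_le_pow_iff_left₀ hs.le hσ.le (by norm_num)).1 hst
  have h1 : 4 * b - k * s * n ≤ L := by linarith [(abs_le.1 hL).1]
  have h2 : (4 * b - k * s * n) / (2 * σ) ≤ L / (2 * σ) := by gcongr
  have h3 : Q / (4 * t * σ) ≤ (4 * t * b + k * s ^ 3 * n) / (4 * t * σ) := by gcongr
  have h4 : (4 * b - k * s * n) / (2 * σ) - (4 * t * b + k * s ^ 3 * n) / (4 * t * σ)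
      = b / σ - (k * s * n / (2 * σ)) - k * s ^ 3 * n / (4 * t * σ) := by field_simp; ring
  have h5 : k * s * n / (2 * σ) ≤ k * n / 2 := by
    rw [div_le_div_iff₀ (by positivity) (by norm_num)]
    have : k * n * s ≤ k * n * σ := by gcongr
    linarith
  have h6 : k * s ^ 3 * n / (4 * t * σ) ≤ k * n / 4 := by
    rw [div_le_div_iff₀ (by positivity) (by norm_num)]
    have : k * n * (s ^ 2 * s) ≤ k * n * (t * σ) := by gcongr
    linarith
  have : 0 ≤ k * n := by positivity
  linarith

theorem real_chi_lower {t σ s n b k L Q B S R : ℝ} (hs : 0 < s) (hn : 0 ≤ n) (hk : 0 ≤ k)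
    (hσ : 0 < σ) (hσt : σ ^ 2 = t) (hB : 1 ≤ B) (hR : 0 < R) (hR1 : R ≤ 1) (hsS : s ≤ S)
    (hst : s ^ 2 ≤ t) (htB : t ≤ B * s ^ 2) (hb : n ≤ b) (hbB : b ≤ B * n)
    (hL : |L - 4 * b| ≤ k * s * n) (hQ0 : 0 ≤ Q) (hQ : Q ≤ 4 * t * b + k * s ^ 3 * n) :
    -((4 * B + k * S + 2 * k ^ 2 * B) / R) * n ≤
      (1 / t - 1 / (t + R) + 2 * k * B * (1 / (2 * σ))) * L
      + (-1 / t ^ 2 + 1 / (t + R) ^ 2 - 2 * k * B * (1 / (4 * t * σ))) * Q := by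
  have ht : 0 < t := lt_of_lt_of_le (by positivity) hst
  have a1 := real_log_lower hs hn hk hst hL hQ
  have a2 := real_sqrt_lower hs hn hk hσ hσt hst hL hQ
  have hσB : σ ≤ B * s := by
    have : σ ^ 2 ≤ (B * s) ^ 2 := by rw [hσt]; nlinarith [sq_nonneg s]
    exact (pow_le_pow_iff_left₀ hσ.le (by positivity) (by norm_num)).1 this
  have a3 : n / (B * s) ≤ b / σ := by gcongr; linarith
  have a4 : -((4 * B + k * S) * n / R) ≤ -(L / (t + R)) + Q / (t + R) ^ 2 := by
    have h1 : L ≤ (4 * B + k * S) * n := by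
      have := (abs_le.1 hL).2
      have h2 : k * s * n ≤ k * S * n := by gcongr
      nlinarith
    have h3 : 0 ≤ (4 * B + k * S) * n := by
      have : 0 ≤ S := by linarith
      positivity
    have h4 : L / (t + R) ≤ (4 * B + k * S) * n / R := by
      calc L / (t + R) ≤ (4 * B + k * S) * n / (t + R) := by gcongr
        _ ≤ _ := by gcongr; linarith
    have : 0 ≤ Q / (t + R) ^ 2 := by positivity
    linarith
  have a5 : 2 * k * B * (n / (B * s) - k * n) ≤ 2 * k * B * (L / (2 * σ) - Q / (4 * t * σ)) :=
    mul_le_mul_of_nonneg_left (by linarith) (by positivity)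
  have a6 : 2 * k * B * (n / (B * s) - k * n) = 2 * k * n / s - 2 * k ^ 2 * B * n := by
    field_simp
  have a7 : 2 * k ^ 2 * B * n ≤ 2 * k ^ 2 * B * n / R := by
    rw [le_div_iff₀ hR]
    have : 0 ≤ 2 * k ^ 2 * B * n := by positivity
    nlinarith
  have e : (1 / t - 1 / (t + R) + 2 * k * B * (1 / (2 * σ))) * L
      + (-1 / t ^ 2 + 1 / (t + R) ^ 2 - 2 * k * B * (1 / (4 * t * σ))) * Q
      = (L / t - Q / t ^ 2) + (-(L / (t + R)) + Q / (t + R) ^ 2)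
        + 2 * k * B * (L / (2 * σ) - Q / (4 * t * σ)) := by ring
  rw [e]
  have e2 : -((4 * B + k * S + 2 * k ^ 2 * B) / R) * n
      = -((4 * B + k * S) * n / R) - 2 * k ^ 2 * B * n / R := by ring
  rw [e2]
  linarith

theorem real_phi_upper {t σ s k L Q : ℝ} (hs : 0 < s) (hk : 0 < k) (hks : k * s ≤ 1 / 2)
    (hσ : 0 < σ) (hσt : σ ^ 2 = t) (hst : s ^ 2 ≤ t)
    (hL : |L - 4 * t| ≤ k * s * s ^ 2) (hQ0 : 4 * t ^ 2 ≤ Q)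
    (hQ : Q ≤ 4 * t * t + k * s ^ 3 * s ^ 2) :
    (1 / t - 4 * k * (1 / (2 * σ))) * L + (-1 / t ^ 2 + 4 * k * (1 / (4 * t * σ))) * Q < 0 := by
  have ht : 0 < t := lt_of_lt_of_le (by positivity) hst
  have a2 := real_sqrt_lower hs (sq_nonneg s) hk.le hσ hσt hst hL hQ
  have hsσ : s ≤ σ := by
    rw [← hσt] at hst; exact (pow_le_pow_iff_left₀ hs.le hσ.le (by norm_num)).1 hst
  have a3 : t / σ = σ := by rw [← hσt]; field_simp
  rw [a3] at a2
  have a4 : L / t ≤ 4 + k * s := by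
    rw [div_le_iff₀ ht]
    have := (abs_le.1 hL).2
    have h2 : k * s * s ^ 2 ≤ k * s * t := by gcongr
    linarith
  have a5 : 4 ≤ Q / t ^ 2 := by rw [le_div_iff₀ (by positivity)]; exact hQ0
  have a6 : s / 2 ≤ σ - k * s ^ 2 := by nlinarith
  have a7 : 4 * k * (s / 2) ≤ 4 * k * (L / (2 * σ) - Q / (4 * t * σ)) :=
    mul_le_mul_of_nonneg_left (by linarith) (by positivity)
  have e : (1 / t - 4 * k * (1 / (2 * σ))) * L + (-1 / t ^ 2 + 4 * k * (1 / (4 * t * σ))) * Q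
      = L / t - Q / t ^ 2 - 4 * k * (L / (2 * σ) - Q / (4 * t * σ)) := by ring
  rw [e]
  nlinarith [mul_pos hk hs]

theorem sqrt_deriv2 {t : ℝ} (ht : 0 < t) :
    HasDerivAt (fun t : ℝ => 1 / (2 * √t)) (-(1 / (4 * t * √t))) t := by
  have h0 : 0 < √t := Real.sqrt_pos.2 ht
  have h1 : HasDerivAt (fun t : ℝ => 2 * √t) (2 * (1 / (2 * √t))) t :=
    (Real.hasDerivAt_sqrt ht.ne').const_mul 2
  have h2 := h1.fun_inv (by positivity)
  have h3 : (fun t : ℝ => 1 / (2 * √t)) = fun t => (2 * √t)⁻¹ := by funext; simp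
  rw [h3]
  refine h2.congr_deriv ?_
  have : √t ^ 2 = t := Real.sq_sqrt ht.le
  rw [mul_pow, this]
  field_simp
  norm_num

end RealIneq

section PshFunctions

variable {E : Type*} [NormedAddCommGroup E] [NormedSpace ℝ E]

/-- The radial profile of the singular plurisubharmonic function. -/
noncomputable def chi (A R t : ℝ) : ℝ := Real.log t - Real.log (t + R) + A * √t

/-- The radial profile of the barrier. -/
noncomputable def phi (A t : ℝ) : ℝ := Real.log t - A * √t

theorem chi_lev {J : E → E →L[ℝ] E} {β : E →L[ℝ] E →L[ℝ] ℝ} {p z : E} {B C S R : ℝ}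
    (h : Adapted β (J p) B) (hc : Ctl J C p z) (hz : z ≠ p) (hR : 0 < R) (hR1 : R ≤ 1)
    (hS : ‖z - p‖ ≤ S) (v : E) :
    -((4 * B + (8 * B ^ 2 * C ^ 2) * S + 2 * (8 * B ^ 2 * C ^ 2) ^ 2 * B) / R) * ‖v‖ ^ 2 ≤
      lev J (fun x => chi (2 * (8 * B ^ 2 * C ^ 2) * B) R (qn β p x)) z v := by
  have hB := h.one_le
  have hC := hc.one_le
  have hs : 0 < ‖z - p‖ := norm_pos_iff.2 (sub_ne_zero.2 hz)
  have hst := qn_lower h z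
  have ht : 0 < qn β p z := lt_of_lt_of_le (by positivity) hst
  have hσ : 0 < √(qn β p z) := Real.sqrt_pos.2 ht
  set k := 8 * B ^ 2 * C ^ 2 with hk
  have hk0 : 0 ≤ k := by positivity
  have key := lev_chi (J := J) (r := qn β p) (p := z) (χ := chi (2 * k * B) R)
    (χ1 := fun t => 1 / t - 1 / (t + R) + 2 * k * B * (1 / (2 * √t)))
    (χ2 := -1 / (qn β p z) ^ 2 + 1 / (qn β p z + R) ^ 2
      - 2 * k * B * (1 / (4 * qn β p z * √(qn β p z))))
    (qn_contDiff β p).contDiffAt hc.diff hc.sq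
    (by
      filter_upwards [lt_mem_nhds ht] with t ht'
      have h1 : HasDerivAt (fun t : ℝ => t + R) 1 t := (hasDerivAt_id t).add_const R
      have h2 := ((Real.hasDerivAt_log ht'.ne').sub (h1.log (by positivity))).add
        ((Real.hasDerivAt_sqrt ht'.ne').const_mul (2 * k * B))
      refine h2.congr_deriv ?_
      simp)
    (by
      set t := qn β p z
      have h1 : HasDerivAt (fun t : ℝ => t + R) 1 t := (hasDerivAt_id t).add_const R
      have h2 := ((hasDerivAt_inv ht.ne').sub (h1.fun_inv (by positivity))).add
        ((sqrt_deriv2 ht).const_mul (2 * k * B))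
      have h3 := h2.congr_deriv (g' := -1 / t ^ 2 + 1 / (t + R) ^ 2
        - 2 * k * B * (1 / (4 * t * √t))) (by ring)
      refine h3.congr_of_eventuallyEq (Eventually.of_forall fun x => ?_)
      simp) v
  rw [key]
  exact real_chi_lower hs (sq_nonneg _) hk0 hσ (Real.sq_sqrt ht.le) hB hR hR1 hS hst
    (qn_upper h z) (h.lower v) (by
      have := (le_abs_self _).trans (h.upper v v)
      linarith [sq ‖v‖]) (quad_lev h hc v) (by positivity) (quad_grad h hc v)

theorem phi_lev {J : E → E →L[ℝ] E} {β : E →L[ℝ] E →L[ℝ] ℝ} {p z : E} {B C : ℝ}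
    (h : Adapted β (J p) B) (hc : Ctl J C p z) (hz : z ≠ p)
    (hS : (8 * B ^ 2 * C ^ 2) * ‖z - p‖ ≤ 1 / 2) :
    lev J (fun x => phi (4 * (8 * B ^ 2 * C ^ 2)) (qn β p x)) z (z - p) < 0 := by
  have hB := h.one_le
  have hC := hc.one_le
  have hs : 0 < ‖z - p‖ := norm_pos_iff.2 (sub_ne_zero.2 hz)
  have hst := qn_lower h z
  have ht : 0 < qn β p z := lt_of_lt_of_le (by positivity) hst
  have hσ : 0 < √(qn β p z) := Real.sqrt_pos.2 ht
  set k := 8 * B ^ 2 * C ^ 2 with hk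
  have hk0 : 0 < k := by positivity
  have key := lev_chi (J := J) (r := qn β p) (p := z) (χ := phi (4 * k))
    (χ1 := fun t => 1 / t - 4 * k * (1 / (2 * √t)))
    (χ2 := -1 / (qn β p z) ^ 2 + 4 * k * (1 / (4 * qn β p z * √(qn β p z))))
    (qn_contDiff β p).contDiffAt hc.diff hc.sq
    (by
      filter_upwards [lt_mem_nhds ht] with t ht'
      have h2 := (Real.hasDerivAt_log ht'.ne').sub
        ((Real.hasDerivAt_sqrt ht'.ne').const_mul (4 * k))
      refine h2.congr_deriv ?_
      simp)
    (by
      set t := qn β p z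
      have h2 := (hasDerivAt_inv ht.ne').sub ((sqrt_deriv2 ht).const_mul (4 * k))
      have h3 := h2.congr_deriv (g' := -1 / t ^ 2 + 4 * k * (1 / (4 * t * √t))) (by ring)
      refine h3.congr_of_eventuallyEq (Eventually.of_forall fun x => ?_)
      simp) (z - p)
  rw [key]
  refine real_phi_upper hs hk0 hS hσ (Real.sq_sqrt ht.le) hst (quad_lev h hc (z - p)) ?_
    (quad_grad h hc (z - p))
  rw [(qn_hasFDerivAt β h.symm p z).fderiv]
  have : (2 • β (z - p)) (z - p) = 2 * qn β p z := by simp [qn]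
  rw [this]
  nlinarith [sq_nonneg ((2 • β (z - p)) (J z (z - p)))]

theorem chi_contDiffAt {A R t : ℝ} (ht : 0 < t) (hR : 0 < R) : ContDiffAt ℝ 2 (chi A R) t := by
  unfold chi
  have h1 : ContDiffAt ℝ 2 (fun t : ℝ => Real.log (t + R)) t :=
    (contDiffAt_id.add contDiffAt_const).log (by simp; positivity)
  have h2 : ContDiffAt ℝ 2 (fun t : ℝ => √t) t := contDiffAt_id.sqrt (by simpa using ht.ne')
  exact ((contDiffAt_id.log (by simpa using ht.ne')).sub h1).add (contDiffAt_const.mul h2)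

theorem phi_contDiffAt {A t : ℝ} (ht : 0 < t) : ContDiffAt ℝ 2 (phi A) t := by
  unfold phi
  have h2 : ContDiffAt ℝ 2 (fun t : ℝ => √t) t := contDiffAt_id.sqrt (by simpa using ht.ne')
  exact (contDiffAt_id.log (by simpa using ht.ne')).sub (contDiffAt_const.mul h2)

end PshFunctions

section MaxPrinciple

variable {E : Type*} [NormedAddCommGroup E] [NormedSpace ℝ E] [ProperSpace E]

theorem punct_max_eps {J : E → E →L[ℝ] E} {w φ : E → ℝ} {x : E} {r C0 m Cx ε : ℝ}
    (hε : 0 < ε) (hε1 : ε < 1)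
    (hw : ∀ y ∈ closedBall x r, y ≠ x → ContDiffAt ℝ 2 w y)
    (hφ : ∀ y ∈ closedBall x r, y ≠ x → ContDiffAt ℝ 2 φ y)
    (hJ : ∀ y ∈ closedBall x r, DifferentiableAt ℝ J y)
    (hJ2 : ∀ y ∈ closedBall x r, ∀ v, J y (J y v) = -v)
    (hl : ∀ y ∈ closedBall x r, y ≠ x → ∃ v, 0 ≤ lev J w y v ∧ lev J φ y v < 0)
    (hsph : ∀ y ∈ closedBall x r, ‖y - x‖ = r → y ≠ x → w y ≤ C0 ∧ m ≤ φ y)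
    (hnear : ∀ᶠ y in 𝓝[≠] x, w y - φ y ≤ Cx)
    (hbot : Tendsto φ (𝓝[≠] x) atBot) :
    ∀ y ∈ closedBall x r, y ≠ x → w y + (-(1 - ε)) * φ y ≤ C0 - (1 - ε) * m := by
  intro y1 hy1 hy1x
  by_contra hcon
  push Not at hcon
  set H : E → ℝ := fun y => w y + (-(1 - ε)) * φ y with hH
  have hHc : ∀ y ∈ closedBall x r, y ≠ x → ContDiffAt ℝ 2 H y := fun y hy hyx =>
    (hw y hy hyx).add (contDiffAt_const.mul (hφ y hy hyx))
  have hnear2 : ∀ᶠ y in 𝓝[≠] x, H y < H y1 := by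
    have h1 : ∀ᶠ y in 𝓝[≠] x, φ y < (H y1 - Cx) / ε := hbot.eventually_lt_atBot _
    filter_upwards [hnear, h1] with y ha hb
    rw [lt_div_iff₀ hε] at hb
    simp only [hH] at hb ⊢
    nlinarith
  rw [eventually_nhdsWithin_iff, Metric.eventually_nhds_iff] at hnear2
  obtain ⟨η, hη, hη2⟩ := hnear2
  set S := closedBall x r \ ball x η with hS
  have hScomp : IsCompact S := (isCompact_closedBall x r).diff isOpen_ball
  have hSne : ∀ y ∈ S, y ≠ x := by
    rintro y hy rfl
    exact hy.2 (mem_ball_self hη)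
  have hy1S : y1 ∈ S := by
    refine ⟨hy1, fun hb => ?_⟩
    exact lt_irrefl _ (hη2 hb hy1x)
  obtain ⟨y, hyS, hmax⟩ := hScomp.exists_isMaxOn ⟨y1, hy1S⟩
    (fun y hy => (hHc y hy.1 (hSne y hy)).continuousAt.continuousWithinAt)
  have hHy : H y1 ≤ H y := hmax hy1S
  have hyx := hSne y hyS
  have hyr : ‖y - x‖ ≠ r := by
    intro he
    obtain ⟨ha, hb⟩ := hsph y hyS.1 he hyx
    have : H y ≤ C0 - (1 - ε) * m := by simp only [hH]; nlinarith
    have h2 : C0 - (1 - ε) * m < H y1 := hcon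
    linarith
  have hyb : y ∈ ball x r := by
    have := hyS.1
    rw [mem_closedBall, dist_eq_norm] at this
    rw [mem_ball, dist_eq_norm]
    exact lt_of_le_of_ne this hyr
  have hloc : IsLocalMax H y := by
    filter_upwards [isOpen_ball.mem_nhds hyb, isOpen_ne.mem_nhds hyx] with z hz1 hz2
    by_cases hz : z ∈ ball x η
    · exact (hη2 hz hz2).le.trans hHy
    · exact hmax ⟨ball_subset_closedBall hz1, hz⟩
  obtain ⟨v, hv1, hv2⟩ := hl y hyS.1 hyx
  have h1 := lev_max (hHc y hyS.1 hyx) (hJ y hyS.1) (hJ2 y hyS.1) hloc v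
  have h2 := lev_comb (hw y hyS.1 hyx) (hφ y hyS.1 hyx) (hJ y hyS.1) (-(1 - ε)) v
  rw [h2] at h1
  nlinarith

theorem punct_max {J : E → E →L[ℝ] E} {w φ : E → ℝ} {x : E} {r C0 m Cx : ℝ}
    (hw : ∀ y ∈ closedBall x r, y ≠ x → ContDiffAt ℝ 2 w y)
    (hφ : ∀ y ∈ closedBall x r, y ≠ x → ContDiffAt ℝ 2 φ y)
    (hJ : ∀ y ∈ closedBall x r, DifferentiableAt ℝ J y)
    (hJ2 : ∀ y ∈ closedBall x r, ∀ v, J y (J y v) = -v)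
    (hl : ∀ y ∈ closedBall x r, y ≠ x → ∃ v, 0 ≤ lev J w y v ∧ lev J φ y v < 0)
    (hsph : ∀ y ∈ closedBall x r, ‖y - x‖ = r → y ≠ x → w y ≤ C0 ∧ m ≤ φ y)
    (hnear : ∀ᶠ y in 𝓝[≠] x, w y - φ y ≤ Cx)
    (hbot : Tendsto φ (𝓝[≠] x) atBot) :
    ∀ y ∈ closedBall x r, y ≠ x → w y ≤ φ y + C0 - m := by
  intro y hy hyx
  have h1 : ∀ᶠ ε in 𝓝[>] (0 : ℝ), w y + (-(1 - ε)) * φ y ≤ C0 - (1 - ε) * m := by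
    filter_upwards [Ioo_mem_nhdsGT (zero_lt_one (α := ℝ))] with ε hε
    exact punct_max_eps hε.1 hε.2 hw hφ hJ hJ2 hl hsph hnear hbot y hy hyx
  have h2 : Tendsto (fun ε : ℝ => w y + (-(1 - ε)) * φ y) (𝓝[>] 0)
      (𝓝 (w y + (-(1 - 0)) * φ y)) := by
    apply Tendsto.mono_left _ nhdsWithin_le_nhds
    apply Continuous.tendsto; fun_prop
  have h3 : Tendsto (fun ε : ℝ => C0 - (1 - ε) * m) (𝓝[>] 0) (𝓝 (C0 - (1 - 0) * m)) := by
    apply Tendsto.mono_left _ nhdsWithin_le_nhds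
    apply Continuous.tendsto; fun_prop
  have := le_of_tendsto_of_tendsto h2 h3 h1
  linarith

theorem sqrt_qn_le {β : E →L[ℝ] E →L[ℝ] ℝ} {J : E → E →L[ℝ] E} {p : E} {B : ℝ}
    (h : Adapted β (J p) B) (z : E) : √(qn β p z) ≤ B * ‖z - p‖ := by
  have hB := h.one_le
  rw [Real.sqrt_le_left (by positivity)]
  have := qn_upper h z
  nlinarith [sq_nonneg ‖z - p‖]

theorem grad_core {J J' : E → E →L[ℝ] E} {β β' : E →L[ℝ] E →L[ℝ] ℝ} {f : E → E} {ρ' : E → ℝ}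
    {x : E} {r B C S δ cL M0 : ℝ} (hr : 0 < r) (hδ : 0 < δ) (hδ1 : δ ≤ 1) (hcL : 0 < cL)
    (hβ : Adapted β (J x) B) (hβ' : Adapted β' (J' (f x)) B)
    (hctl : ∀ y ∈ closedBall x r, Ctl J C x y)
    (hctl' : ∀ y ∈ closedBall x r, Ctl J' C (f x) (f y))
    (hk : (8 * B ^ 2 * C ^ 2) * r ≤ 1 / 2)
    (hf : ∀ y ∈ closedBall x r, ContDiffAt ℝ 2 f y)
    (hol : ∀ y ∈ closedBall x r, ∀ᶠ z in 𝓝 y,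
      (fderiv ℝ f z).comp (J z) = (J' (f z)).comp (fderiv ℝ f z))
    (hinj : ∀ y ∈ closedBall x r, f y = f x → y = x)
    (hρ : ∀ y ∈ closedBall x r, ContDiffAt ℝ 2 ρ' (f y))
    (hρneg : ∀ y ∈ closedBall x r, ρ' (f y) ≤ 0)
    (hρlow : ∀ y ∈ closedBall x r, -ρ' (f y) ≤ M0 * δ)
    (hlev : ∀ y ∈ closedBall x r, ∀ v, cL * ‖v‖ ^ 2 ≤ lev J' ρ' (f y) v)
    (hS : ∀ y ∈ closedBall x r, ‖f y - f x‖ ≤ S) :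
    ‖fderiv ℝ f x‖ ≤ √(2 * δ * Real.exp (2 * (8 * B ^ 2 * C ^ 2) * B * (B * S) + 2 * B
      + (4 * B + (8 * B ^ 2 * C ^ 2) * S + 2 * (8 * B ^ 2 * C ^ 2) ^ 2 * B) * M0 / cL) * B) / r := by
  have hxm : x ∈ closedBall x r := mem_closedBall_self hr.le
  have hB := hβ.one_le
  have hC := (hctl x hxm).one_le
  have hS0 : 0 ≤ S := (norm_nonneg _).trans (hS x hxm)
  set k := 8 * B ^ 2 * C ^ 2 with hkdef
  set K := 4 * B + k * S + 2 * k ^ 2 * B with hK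
  have hk0 : 0 < k := by positivity
  have hK0 : 0 < K := by positivity
  set lam := K / (cL * δ) with hlam
  have hlam0 : 0 < lam := by positivity
  set p := f x with hp
  set w : E → ℝ := fun y => chi (2 * k * B) δ (qn β' p (f y)) + lam * ρ' (f y) with hw
  set φ : E → ℝ := fun y => phi (4 * k) (qn β x y) with hφ
  have hM : ∀ y, y ≠ x → 0 < qn β x y := fun y hy =>
    lt_of_lt_of_le (by have := norm_pos_iff.2 (sub_ne_zero.2 hy); positivity) (qn_lower hβ y)
  have hN : ∀ y ∈ closedBall x r, y ≠ x → 0 < qn β' p (f y) := fun y hy hyx =>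
    lt_of_lt_of_le (by
      have := norm_pos_iff.2 (sub_ne_zero.2 (fun h => hyx (hinj y hy h))); positivity)
      (qn_lower hβ' (f y))
  have hΨ : ∀ y ∈ closedBall x r, y ≠ x →
      ContDiffAt ℝ 2 (fun z => chi (2 * k * B) δ (qn β' p z)) (f y) := fun y hy hyx =>
    (chi_contDiffAt (hN y hy hyx) hδ).comp (f y) (qn_contDiff β' p).contDiffAt
  have hw0 : ∀ y ∈ closedBall x r, y ≠ x → w y ≤ 2 * k * B * (B * S) := by
    intro y hy hyx
    have h1 : Real.log (qn β' p (f y)) - Real.log (qn β' p (f y) + δ) ≤ 0 := by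
      have := Real.log_le_log (hN y hy hyx) (by linarith : qn β' p (f y) ≤ qn β' p (f y) + δ)
      linarith
    have h2 : 2 * k * B * √(qn β' p (f y)) ≤ 2 * k * B * (B * S) := by
      have h3 := sqrt_qn_le hβ' (f y)
      have h4 := hS y hy
      gcongr
      exact h3.trans (by gcongr)
    have h3 : lam * ρ' (f y) ≤ 0 := mul_nonpos_of_nonneg_of_nonpos hlam0.le (hρneg y hy)
    simp only [hw, chi]
    linarith
  have hwC : ∀ y ∈ closedBall x r, y ≠ x → ContDiffAt ℝ 2 w y := fun y hy hyx =>
    ((hΨ y hy hyx).comp y (hf y hy)).add (contDiffAt_const.mul ((hρ y hy).comp y (hf y hy)))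
  have hφC : ∀ y ∈ closedBall x r, y ≠ x → ContDiffAt ℝ 2 φ y := fun y hy hyx =>
    (phi_contDiffAt (hM y hyx)).comp y (qn_contDiff β x).contDiffAt
  have hfx : HasFDerivAt f (fderiv ℝ f x) x :=
    ((hf x hxm).differentiableAt (by norm_num)).hasFDerivAt
  have hMt : Tendsto (qn β x) (𝓝[≠] x) (𝓝[>] 0) := by
    rw [tendsto_nhdsWithin_iff]
    constructor
    · have h1 : Tendsto (qn β x) (𝓝 x) (𝓝 (qn β x x)) :=
        (qn_contDiff β x (k := 2)).continuous.tendsto x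
      have h2 : qn β x x = 0 := by simp [qn]
      rw [h2] at h1
      exact h1.mono_left nhdsWithin_le_nhds
    · filter_upwards [self_mem_nhdsWithin] with y hy using hM y hy
  have hlog : Tendsto (fun y => Real.log (qn β x y)) (𝓝[≠] x) atBot :=
    Real.tendsto_log_nhdsGT_zero.comp hMt
  have hball : ∀ᶠ y in 𝓝[≠] x, y ∈ closedBall x r :=
    nhdsWithin_le_nhds (closedBall_mem_nhds x hr)
  have hbot : Tendsto φ (𝓝[≠] x) atBot := by
    refine tendsto_atBot_mono (fun y => ?_) hlog
    have : 0 ≤ 4 * k * √(qn β x y) := by positivity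
    simp only [hφ, phi]
    linarith
  obtain ⟨Lf, hLf⟩ := hfx.isBigO_sub.bound
  have hnear : ∀ᶠ y in 𝓝[≠] x, w y - φ y ≤
      Real.log (B * (|Lf| + 1) ^ 2) - Real.log δ + 2 * k * B * (B * S) + 4 * k * (B * r) := by
    filter_upwards [nhdsWithin_le_nhds hLf, hball, self_mem_nhdsWithin] with y h1 h2 h3
    have hyx : y ≠ x := h3
    have hNy := hN y h2 hyx
    have hMy := hM y hyx
    have e1 : qn β' p (f y) ≤ (B * (|Lf| + 1) ^ 2) * qn β x y := by
      have a1 := qn_upper hβ' (f y)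
      have a2 := qn_lower hβ y
      have a3 : ‖f y - p‖ ≤ (|Lf| + 1) * ‖y - x‖ := h1.trans (by
        gcongr; linarith [le_abs_self Lf])
      calc qn β' p (f y) ≤ B * ‖f y - p‖ ^ 2 := a1
        _ ≤ B * ((|Lf| + 1) * ‖y - x‖) ^ 2 := by gcongr
        _ = (B * (|Lf| + 1) ^ 2) * ‖y - x‖ ^ 2 := by ring
        _ ≤ _ := by gcongr
    have e2 := Real.log_le_log hNy e1
    rw [Real.log_mul (by positivity) hMy.ne'] at e2
    have e3 : Real.log δ ≤ Real.log (qn β' p (f y) + δ) := Real.log_le_log hδ (by linarith)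
    have e4 : 2 * k * B * √(qn β' p (f y)) ≤ 2 * k * B * (B * S) := by
      have h3 := sqrt_qn_le hβ' (f y)
      have h4 := hS y h2
      gcongr
      exact h3.trans (by gcongr)
    have e5 : lam * ρ' (f y) ≤ 0 := mul_nonpos_of_nonneg_of_nonpos hlam0.le (hρneg y h2)
    have e6 : 4 * k * √(qn β x y) ≤ 4 * k * (B * r) := by
      have h3 := sqrt_qn_le hβ y
      have h4 : ‖y - x‖ ≤ r := by rwa [mem_closedBall, dist_eq_norm] at h2
      gcongr
      exact h3.trans (by gcongr)
    simp only [hw, hφ, chi, phi]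
    linarith
  have hl : ∀ y ∈ closedBall x r, y ≠ x → ∃ v, 0 ≤ lev J w y v ∧ lev J φ y v < 0 := by
    intro y hy hyx
    refine ⟨y - x, ?_, ?_⟩
    · have hyp : f y ≠ p := fun h => hyx (hinj y hy h)
      have h1 := lev_pullback (J := J) (J' := J') (u := fun z => chi (2 * k * B) δ (qn β' p z)
        + lam * ρ' z) (f := f) (p := y) ((hΨ y hy hyx).add (contDiffAt_const.mul (hρ y hy)))
        (hf y hy) (hctl' y hy).diff (hol y hy) (y - x)
      rw [hw, h1, lev_comb (hΨ y hy hyx) (hρ y hy) (hctl' y hy).diff]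
      have h2 := chi_lev hβ' (hctl' y hy) hyp hδ hδ1 (hS y hy) (fderiv ℝ f y (y - x))
      have h3 := mul_le_mul_of_nonneg_left (hlev y hy (fderiv ℝ f y (y - x))) hlam0.le
      have h4 : lam * (cL * ‖fderiv ℝ f y (y - x)‖ ^ 2)
          = K / δ * ‖fderiv ℝ f y (y - x)‖ ^ 2 := by
        rw [hlam]; field_simp
      have h5 : -(K / δ) * ‖fderiv ℝ f y (y - x)‖ ^ 2
        = -(K / δ * ‖fderiv ℝ f y (y - x)‖ ^ 2) := by ring
      rw [← hkdef, ← hK] at h2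
      linarith
    · refine phi_lev hβ (hctl y hy) hyx ?_
      have h4 : ‖y - x‖ ≤ r := by rwa [mem_closedBall, dist_eq_norm] at hy
      exact le_trans (by gcongr) hk
  have hmain := punct_max (J := J) (w := w) (φ := φ) (x := x) (r := r) (C0 := 2 * k * B * (B * S))
    (m := Real.log (r ^ 2) - 2 * B) hwC hφC (fun y hy => (hctl y hy).diff)
    (fun y hy => (hctl y hy).sq) hl (by
      intro y hy hyr hyx
      refine ⟨hw0 y hy hyx, ?_⟩
      have h1 := qn_lower hβ y
      have h2 := sqrt_qn_le hβ y
      rw [hyr] at h1 h2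
      have h3 := Real.log_le_log (by positivity) h1
      have h4 : 4 * k * √(qn β x y) ≤ 4 * k * (B * r) := by gcongr
      have h5 : 4 * k * (B * r) ≤ 2 * B := by nlinarith
      simp only [hφ, phi]
      linarith) hnear hbot
  set T := 2 * k * B * (B * S) + 2 * B + K * M0 / cL with hT
  have hmain2 : ∀ y ∈ closedBall x r, qn β' p (f y) ≤
      (qn β' p (f y) + δ) * (Real.exp T * (B * ‖y - x‖ ^ 2 / r ^ 2)) := by
    intro y hy
    by_cases hyx : y = x
    · simp [hyx, qn, hp]
    have h1 := hmain y hy hyx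
    have hNy := hN y hy hyx
    have hMy := hM y hyx
    have h2 : lam * (-ρ' (f y)) ≤ K * M0 / cL := by
      calc lam * (-ρ' (f y)) ≤ lam * (M0 * δ) := by
            have := hρlow y hy; gcongr
        _ = _ := by rw [hlam]; field_simp
    have h3 : 0 ≤ 2 * k * B * √(qn β' p (f y)) := by positivity
    have h4 : 0 ≤ 4 * k * √(qn β x y) := by positivity
    have h5 : Real.log (qn β' p (f y)) ≤ Real.log ((qn β' p (f y) + δ) *
        (Real.exp T * (qn β x y / r ^ 2))) := by
      rw [Real.log_mul (by positivity) (by positivity), Real.log_mul (by positivity) (by positivity),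
        Real.log_exp, Real.log_div hMy.ne' (by positivity)]
      simp only [hw, hφ, chi, phi] at h1
      linarith
    have h6 := (Real.log_le_log_iff hNy (by positivity)).1 h5
    refine h6.trans ?_
    have := qn_upper hβ y
    gcongr
  have hNt : ∀ᶠ y in 𝓝 x, qn β' p (f y) < δ := by
    have h1 : ContinuousAt (fun y => qn β' p (f y)) x :=
      (qn_contDiff β' p (k := 2)).continuous.continuousAt.comp hfx.continuousAt
    have h2 : qn β' p (f x) < δ := by simpa [qn, hp] using hδ
    exact h1.eventually (gt_mem_nhds h2)
  refine hfx.le_of_lip' (by positivity) ?_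
  filter_upwards [hNt, closedBall_mem_nhds x hr] with y h1 h2
  have h3 := hmain2 y h2
  have h4 := qn_lower hβ' (f y)
  have h5 : ‖f y - f x‖ ^ 2 ≤ 2 * δ * Real.exp T * B * (‖y - x‖ / r) ^ 2 := by
    calc ‖f y - f x‖ ^ 2 ≤ qn β' p (f y) := h4
      _ ≤ _ := h3
      _ ≤ (2 * δ) * (Real.exp T * (B * ‖y - x‖ ^ 2 / r ^ 2)) := by gcongr; linarith
      _ = _ := by field_simp
  have h6 := Real.sqrt_le_sqrt h5
  rw [Real.sqrt_sq (norm_nonneg _), Real.sqrt_mul (by positivity),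
    Real.sqrt_sq (by positivity)] at h6
  refine h6.trans (le_of_eq ?_)
  ring

end MaxPrinciple

section Domains

variable {E : Type*} [NormedAddCommGroup E] [NormedSpace ℝ E]

/-- The data of a strictly pseudoconvex domain with a defining function, in general form. -/
structure Dom (J : E → E →L[ℝ] E) (D : Set E) (ρ : E → ℝ) (U : Set E) : Prop where
  openU : IsOpen U
  openD : IsOpen D
  bdd : IsBounded D
  sub : closure D ⊆ U
  smooth : ∀ x ∈ U, ContDiffAt ℝ (⊤ : ℕ∞) ρ x
  smoothJ : ∀ x ∈ U, ContDiffAt ℝ (⊤ : ℕ∞) J x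
  sq : ∀ x ∈ U, ∀ v, J x (J x v) = -v
  eq : ∀ x, x ∈ D ↔ x ∈ U ∧ ρ x < 0
  grad : ∀ x ∈ frontier D, fderiv ℝ ρ x ≠ 0
  strict : ∃ W : Set E, IsOpen W ∧ frontier D ⊆ W ∧ ∀ x ∈ W, ∀ v, v ≠ 0 → 0 < lev J ρ x v

theorem lev_continuousOn {J : E → E →L[ℝ] E} {ρ : E → ℝ} {U : Set E}
    (h1 : ∀ x ∈ U, ContDiffAt ℝ (⊤ : ℕ∞) ρ x) (h2 : ∀ x ∈ U, ContDiffAt ℝ (⊤ : ℕ∞) J x) :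
    ContinuousOn (fun q : E × E => lev J ρ q.1 q.2) (U ×ˢ univ) := by
  rintro ⟨x, v⟩ ⟨hx, -⟩
  apply ContinuousAt.continuousWithinAt
  have ha : ContDiffAt ℝ (⊤ : ℕ∞) (fderiv ℝ ρ) x := (h1 x hx).fderiv_right (by simp)
  have hb : ContDiffAt ℝ (⊤ : ℕ∞) (jd J ρ) x := ha.clm_comp (h2 x hx)
  have hc : ContinuousAt (fderiv ℝ (jd J ρ)) x :=
    (hb.fderiv_right (m := (⊤ : ℕ∞)) (by simp)).continuousAt
  have hd : ContinuousAt (fun q : E × E => fderiv ℝ (jd J ρ) q.1) (x, v) :=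
    ContinuousAt.comp (f := Prod.fst) hc continuousAt_fst
  have he : ContinuousAt (fun q : E × E => J q.1) (x, v) :=
    ContinuousAt.comp (f := Prod.fst) (h2 x hx).continuousAt continuousAt_fst
  have hv : ContinuousAt (fun q : E × E => q.2) (x, v) := continuousAt_snd
  have hJv : ContinuousAt (fun q : E × E => J q.1 q.2) (x, v) := he.clm_apply hv
  unfold lev
  exact (((hd.clm_apply hv).clm_apply hJv).sub ((hd.clm_apply hJv).clm_apply hv)).neg

theorem lev_smul (J : E → E →L[ℝ] E) (r : E → ℝ) (p v : E) (a : ℝ) :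
    lev J r p (a • v) = a ^ 2 * lev J r p v := by
  unfold lev
  simp
  ring

variable {J : E → E →L[ℝ] E} {D : Set E} {ρ : E → ℝ} {U : Set E}

theorem Dom.cont (h : Dom J D ρ U) : ContinuousOn ρ (closure D) := fun x hx =>
  (h.smooth x (h.sub hx)).continuousAt.continuousWithinAt

theorem Dom.subD (h : Dom J D ρ U) : D ⊆ U := subset_closure.trans h.sub

theorem Dom.neg (h : Dom J D ρ U) {x : E} (hx : x ∈ D) : ρ x < 0 := ((h.eq x).1 hx).2

theorem Dom.nonpos (h : Dom J D ρ U) {x : E} (hx : x ∈ closure D) : ρ x ≤ 0 :=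
  ContinuousWithinAt.closure_le hx ((h.cont x hx).mono subset_closure)
    continuousWithinAt_const (fun _ hy => (h.neg hy).le)

theorem Dom.frontier_zero (h : Dom J D ρ U) {x : E} (hx : x ∈ frontier D) : ρ x = 0 := by
  rw [h.openD.frontier_eq] at hx
  refine le_antisymm (h.nonpos hx.1) (not_lt.1 fun hlt => hx.2 ?_)
  exact (h.eq x).2 ⟨h.sub hx.1, hlt⟩

variable [ProperSpace E]

theorem Dom.compact (h : Dom J D ρ U) : IsCompact (closure D) := h.bdd.isCompact_closure

theorem Dom.compact_sub (h : Dom J D ρ U) {ε : ℝ} (hε : 0 < ε) : IsCompact {x ∈ D | ρ x ≤ -ε} := by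
  have h1 : {x ∈ D | ρ x ≤ -ε} = closure D ∩ ρ ⁻¹' Iic (-ε) := by
    ext x
    constructor
    · rintro ⟨h1, h2⟩; exact ⟨subset_closure h1, h2⟩
    · rintro ⟨h1, h2⟩
      have h2' : ρ x ≤ -ε := h2
      exact ⟨(h.eq x).2 ⟨h.sub h1, by linarith⟩, h2⟩
  rw [h1]
  exact h.compact.of_isClosed_subset
    (h.cont.preimage_isClosed_of_isClosed isClosed_closure isClosed_Iic) inter_subset_left

theorem Dom.collar (h : Dom J D ρ U) {W : Set E} (hW : IsOpen W) (hfW : frontier D ⊆ W) :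
    ∃ ε > 0, ∀ x ∈ D, -ε < ρ x → x ∈ W := by
  have hK : IsCompact (closure D \ W) := h.compact.diff hW
  have hpos : ∀ x ∈ closure D \ W, 0 < -ρ x := by
    rintro x ⟨h1, h2⟩
    have : x ∈ D := by
      by_contra hx
      exact h2 (hfW (by rw [h.openD.frontier_eq]; exact ⟨h1, hx⟩))
    linarith [h.neg this]
  obtain ⟨ε, hε, h2⟩ := hK.exists_forall_le' (h.cont.neg.mono sdiff_subset) hpos
  refine ⟨ε, hε, fun x hx hlt => ?_⟩
  by_contra hxW
  have := h2 x ⟨subset_closure hx, hxW⟩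
  simp only [Pi.neg_apply] at this
  linarith

theorem Dom.levi_pos (h : Dom J D ρ U) :
    ∃ ε > 0, ∃ c > 0, ∀ x ∈ D, -ε < ρ x → ∀ v, c * ‖v‖ ^ 2 ≤ lev J ρ x v := by
  obtain ⟨W, hW, hfW, hlev⟩ := h.strict
  obtain ⟨ε, hε, hcol⟩ := h.collar hW hfW
  set K := closure D ∩ ρ ⁻¹' Ici (-(ε / 2)) with hK
  have hKc : IsCompact K := h.compact.of_isClosed_subset
    (h.cont.preimage_isClosed_of_isClosed isClosed_closure isClosed_Ici) inter_subset_left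
  have hKW : K ⊆ W := by
    rintro x ⟨h1, h2⟩
    have h2' : -(ε / 2) ≤ ρ x := h2
    by_cases hx : x ∈ D
    · exact hcol x hx (by linarith)
    · exact hfW (by rw [h.openD.frontier_eq]; exact ⟨h1, hx⟩)
  have hcs : IsCompact (K ×ˢ sphere (0 : E) 1) := hKc.prod (isCompact_sphere 0 1)
  obtain ⟨c, hc, hc2⟩ := hcs.exists_forall_le' (a := 0)
    ((lev_continuousOn h.smooth h.smoothJ).mono
      (fun q hq => ⟨h.sub hq.1.1, mem_univ _⟩)) (by
      rintro ⟨x, v⟩ ⟨hx, hv⟩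
      refine hlev x (hKW hx) v ?_
      rintro rfl
      simp at hv)
  refine ⟨ε / 2, by positivity, c, hc, fun x hx hlt v => ?_⟩
  by_cases hv : v = 0
  · simp [hv, lev]
  have hn : 0 < ‖v‖ := norm_pos_iff.2 hv
  have h1 := hc2 (x, ‖v‖⁻¹ • v) ⟨⟨subset_closure hx, hlt.le⟩, by
    simp [norm_smul, hn.ne']⟩
  simp only [lev_smul] at h1
  rw [inv_pow, ← div_eq_inv_mul, le_div_iff₀ (by positivity)] at h1
  exact h1

theorem Dom.grad_pos (h : Dom J D ρ U) :
    ∃ ε > 0, ∃ c > 0, ∀ x ∈ D, -ε < ρ x → c < ‖fderiv ℝ ρ x‖ := by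
  have hcont : ContinuousOn (fun x => ‖fderiv ℝ ρ x‖) U := fun x hx =>
    ((h.smooth x hx).fderiv_right (m := (⊤ : ℕ∞)) (by simp)).continuousAt.norm.continuousWithinAt
  have hfc : IsCompact (frontier D) :=
    h.compact.of_isClosed_subset isClosed_frontier frontier_subset_closure
  obtain ⟨a, ha, ha2⟩ := hfc.exists_forall_le' (a := 0)
    (hcont.mono (frontier_subset_closure.trans h.sub)) (fun x hx => norm_pos_iff.2 (h.grad x hx))
  obtain ⟨ε, hε, hcol⟩ := h.collar (W := U ∩ (fun x => ‖fderiv ℝ ρ x‖) ⁻¹' Ioi (a / 2))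
    (hcont.isOpen_inter_preimage h.openU isOpen_Ioi) (fun x hx =>
      ⟨h.sub (frontier_subset_closure hx), by
        have := ha2 x hx
        simp only [mem_preimage, mem_Ioi]
        linarith⟩)
  exact ⟨ε, hε, a / 2, by positivity, fun x hx hlt => (hcol x hx hlt).2⟩

theorem Dom.levi_bdd (h : Dom J D ρ U) :
    ∃ C > 0, ∀ x ∈ D, ∀ v, ‖v‖ ≤ 1 → lev J ρ x v ≤ C := by
  have hcs : IsCompact (closure D ×ˢ closedBall (0 : E) 1) :=
    h.compact.prod (isCompact_closedBall 0 1)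
  obtain ⟨C, hC⟩ := hcs.exists_bound_of_continuousOn
    ((lev_continuousOn h.smooth h.smoothJ).mono (fun q hq => ⟨h.sub hq.1, mem_univ _⟩))
  refine ⟨|C| + 1, by positivity, fun x hx v hv => ?_⟩
  have h1 := hC (x, v) ⟨subset_closure hx, by simpa using hv⟩
  have h2 := le_abs_self C
  have h3 := (le_abs_self _).trans h1
  simp only at h3
  linarith

theorem lip_compact {F : Type*} [NormedAddCommGroup F] [NormedSpace ℝ F] {g : E → F} {K : Set E}
    (hK : IsCompact K) (hg : ∀ x ∈ K, ContDiffAt ℝ (⊤ : ℕ∞) g x) :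
    ∃ L > 0, ∀ x ∈ K, ∀ y ∈ K, ‖g x - g y‖ ≤ L * ‖x - y‖ := by
  have h1 : LocallyLipschitzOn K g := by
    intro x hx
    obtain ⟨L, t, ht, hL⟩ := ((hg x hx).of_le (m := 1) (by simp)).exists_lipschitzOnWith
    exact ⟨L, t, nhdsWithin_le_nhds ht, hL⟩
  obtain ⟨L, hL⟩ := h1.exists_lipschitzOnWith_of_compact hK
  refine ⟨L + 1, by positivity, fun x hx y hy => ?_⟩
  have := hL.norm_sub_le hx hy
  nlinarith [norm_nonneg (x - y)]

theorem Dom.ctl (h : Dom J D ρ U) : ∃ C, ∀ p ∈ closure D, ∀ z ∈ closure D, Ctl J C p z := by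
  obtain ⟨C1, hC1⟩ := h.compact.exists_bound_of_continuousOn (f := J)
    (fun x hx => (h.smoothJ x (h.sub hx)).continuousAt.continuousWithinAt)
  obtain ⟨C2, hC2⟩ := h.compact.exists_bound_of_continuousOn (f := fderiv ℝ J)
    (fun x hx => ((h.smoothJ x (h.sub hx)).fderiv_right (m := (⊤ : ℕ∞))
      (by simp)).continuousAt.continuousWithinAt)
  obtain ⟨L, hL0, hL⟩ := lip_compact h.compact (fun x hx => h.smoothJ x (h.sub hx))
  refine ⟨|C1| + |C2| + L + 1, fun p hp z hz => ?_⟩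
  have a1 := le_abs_self C1
  have a2 := le_abs_self C2
  have a3 := abs_nonneg C1
  have a4 := abs_nonneg C2
  exact
  { one_le := by linarith
    diff := (h.smoothJ z (h.sub hz)).differentiableAt (by simp)
    sq := h.sq z (h.sub hz)
    nz := (hC1 z hz).trans (by linarith)
    np := (hC1 p hp).trans (by linarith)
    nd := (hC2 z hz).trans (by linarith)
    lip := (hL z hz p hp).trans (by gcongr; linarith) }

theorem Dom.ball_sub (h : Dom J D ρ U) :
    ∃ c > 0, c ≤ 1 ∧ ∀ x ∈ D, ∀ y, ‖y - x‖ ≤ c * (-ρ x) → y ∈ D ∧ -ρ y ≤ 2 * (-ρ x) := by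
  obtain ⟨L, hL0, hL⟩ := lip_compact h.compact (fun x hx => h.smooth x (h.sub hx))
  refine ⟨min 1 (1 / (2 * L)), by positivity, min_le_left _ _, fun x hx y hy => ?_⟩
  have hneg := h.neg hx
  have hc : L * ‖y - x‖ < -ρ x := by
    calc L * ‖y - x‖ ≤ L * (1 / (2 * L) * (-ρ x)) := by
          have := min_le_right 1 (1 / (2 * L))
          have h0 : 0 ≤ -ρ x := by linarith
          gcongr
          exact hy.trans (by gcongr)
      _ = (-ρ x) / 2 := by field_simp
      _ < -ρ x := by linarith
  have hyD : y ∈ D := by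
    by_contra hyD
    obtain ⟨z, hz, hzf⟩ : (segment ℝ x y ∩ frontier D).Nonempty := by
      by_contra hne
      have hsub : segment ℝ x y ⊆ D ∪ (closure D)ᶜ := by
        intro z hz
        by_cases hzD : z ∈ D
        · exact Or.inl hzD
        · refine Or.inr fun hzc => hne ⟨z, hz, ?_⟩
          rw [h.openD.frontier_eq]
          exact ⟨hzc, hzD⟩
      obtain ⟨z, -, hz1, hz2⟩ := (convex_segment (𝕜 := ℝ) x y).isPreconnected D (closure D)ᶜ h.openD
        isClosed_closure.isOpen_compl hsub ⟨x, left_mem_segment ℝ x y, hx⟩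
        ⟨y, right_mem_segment ℝ x y, (hsub (right_mem_segment ℝ x y)).resolve_left hyD⟩
      exact hz2 (subset_closure hz1)
    have h1 := hL z (frontier_subset_closure hzf) x (subset_closure hx)
    rw [h.frontier_zero hzf] at h1
    have h2 : ‖z - x‖ ≤ ‖y - x‖ := norm_sub_le_of_mem_segment hz
    have h3 := (le_abs_self _).trans h1
    nlinarith
  refine ⟨hyD, ?_⟩
  have h1 := (neg_abs_le _).trans' (neg_le_neg (hL y (subset_closure hyD) x (subset_closure hx)))
  linarith

end Domains

theorem two_le_infty : (2 : WithTop ℕ∞) ≤ ((⊤ : ℕ∞) : WithTop ℕ∞) :=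
  WithTop.coe_le_coe.2 (le_top : (2 : ℕ∞) ≤ ⊤)

section Hopf

variable {E : Type*} [NormedAddCommGroup E] [NormedSpace ℝ E] [ProperSpace E]

/-- A biholomorphism of `D` onto `D'`. -/
structure Bih (J J' : E → E →L[ℝ] E) (D D' : Set E) (f g : E → E) : Prop where
  sf : ∀ x ∈ D, ContDiffAt ℝ (⊤ : ℕ∞) f x
  sg : ∀ x ∈ D', ContDiffAt ℝ (⊤ : ℕ∞) g x
  mf : MapsTo f D D'
  mg : MapsTo g D' D
  gf : ∀ x ∈ D, g (f x) = x
  fg : ∀ y ∈ D', f (g y) = y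
  hf : ∀ x ∈ D, (fderiv ℝ f x).comp (J x) = (J' (f x)).comp (fderiv ℝ f x)
  hg : ∀ x ∈ D', (fderiv ℝ g x).comp (J' x) = (J (g x)).comp (fderiv ℝ g x)

theorem Bih.symm {J J' : E → E →L[ℝ] E} {D D' : Set E} {f g : E → E} (h : Bih J J' D D' f g) :
    Bih J' J D' D g f :=
  ⟨h.sg, h.sf, h.mg, h.mf, h.fg, h.gf, h.hg, h.hf⟩

variable {J J' : E → E →L[ℝ] E} {D D' U U' : Set E} {ρ ρ' : E → ℝ} {f g : E → E}

theorem Bih.contf (h : Bih J J' D D' f g) : ContinuousOn f D := fun x hx =>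
  (h.sf x hx).continuousAt.continuousWithinAt

/-- compact sublevels are mapped into compact sublevels -/
theorem Bih.proper (h : Bih J J' D D' f g) (hD : Dom J D ρ U) (hD' : Dom J' D' ρ' U')
    {ε : ℝ} (hε : 0 < ε) : ∃ ε' > 0, ∀ x ∈ D, ρ x ≤ -ε → ρ' (f x) ≤ -ε' := by
  have hc : ContinuousOn (fun x => -ρ' (f x)) {x ∈ D | ρ x ≤ -ε} := by
    intro x hx
    have h1 : ContinuousAt (fun x => ρ' (f x)) x :=
      ContinuousAt.comp (hD'.smooth _ (hD'.subD (h.mf hx.1))).continuousAt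
        (h.sf x hx.1).continuousAt
    exact h1.neg.continuousWithinAt
  obtain ⟨ε', h1, h2⟩ := (hD.compact_sub hε).exists_forall_le' (a := 0) hc
    (fun x hx => by have := hD'.neg (h.mf hx.1); linarith)
  exact ⟨ε', h1, fun x hx hle => by have := h2 x ⟨hx, hle⟩; linarith⟩

theorem Dom.bound (h : Dom J D ρ U) : ∃ M > 0, ∀ x ∈ closure D, -ρ x ≤ M := by
  obtain ⟨C, hC⟩ := h.compact.exists_bound_of_continuousOn h.cont
  refine ⟨|C| + 1, by positivity, fun x hx => ?_⟩
  have h1 := (neg_le_abs _).trans (hC x hx)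
  linarith [le_abs_self C]

theorem barrier_lev (hD : Dom J D ρ U) :
    ∃ ε > 0, ∃ k > 0, ∀ x ∈ D, -ε < ρ x →
      ∃ v, lev J (fun x => 1 - Real.exp (-k * ρ x)) x v < 0 := by
  obtain ⟨ε, hε, c0, hc0, hgr⟩ := hD.grad_pos
  obtain ⟨C, hC, hlev⟩ := hD.levi_bdd
  refine ⟨ε, hε, (C + 1) / c0 ^ 2, by positivity, fun x hx hlt => ?_⟩
  set k := (C + 1) / c0 ^ 2 with hk
  have hk0 : 0 < k := by positivity
  obtain ⟨v, hv1, hv2⟩ := (fderiv ℝ ρ x).exists_lt_apply_of_lt_opNorm (hgr x hx hlt)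
  refine ⟨v, ?_⟩
  have hxU := hD.subD hx
  have hexp : ∀ t : ℝ, HasDerivAt (fun t => Real.exp (-k * t)) (Real.exp (-k * t) * (-k)) t := by
    intro t
    have := ((hasDerivAt_id t).const_mul (-k)).exp
    simpa using this
  rw [lev_chi (χ := fun t => 1 - Real.exp (-k * t)) (χ1 := fun t => k * Real.exp (-k * t))
    (χ2 := k * (Real.exp (-k * ρ x) * (-k)))
    ((hD.smooth x hxU).of_le two_le_infty)
    ((hD.smoothJ x hxU).differentiableAt (by simp)) (hD.sq x hxU)
    (Eventually.of_forall fun t => by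
      have := (hexp t).const_sub 1
      exact this.congr_deriv (by ring)) ((hexp _).const_mul k)]
  have h1 := hlev x hx v hv1.le
  have h2 : c0 ^ 2 < (fderiv ℝ ρ x v) ^ 2 := by
    rw [Real.norm_eq_abs] at hv2
    rw [← sq_abs (fderiv ℝ ρ x v)]
    gcongr
  have h3 := sq_nonneg (fderiv ℝ ρ x (J x v))
  have h4 : k * c0 ^ 2 = C + 1 := by rw [hk]; field_simp
  have h5 : lev J ρ x v - k * ((fderiv ℝ ρ x v) ^ 2 + (fderiv ℝ ρ x (J x v)) ^ 2) < 0 := by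
    nlinarith
  have h6 : 0 < k * Real.exp (-k * ρ x) := by positivity
  have h7 := mul_neg_of_pos_of_neg h6 h5
  linarith

theorem hopf (h : Bih J J' D D' f g) (hD : Dom J D ρ U) (hD' : Dom J' D' ρ' U') :
    ∃ c > 0, ∀ y ∈ D', ρ (g y) ≤ c * ρ' y := by
  obtain ⟨ε, hε, cL, hcL, hL⟩ := hD.levi_pos
  obtain ⟨ε1, hε1, hp1⟩ := h.proper hD hD' hε
  obtain ⟨ε2, hε2, k, hk, hbar⟩ := barrier_lev hD'
  obtain ⟨M, hM, hMb⟩ := hD'.bound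
  set ε3 := min ε1 ε2 / 2 with hε3
  have hε3pos : 0 < ε3 := by positivity
  have h31 : ε3 < ε1 := by have := min_le_left ε1 ε2; linarith
  have h32 : ε3 < ε2 := by have := min_le_right ε1 ε2; linarith
  obtain ⟨m, hm, hp2⟩ := h.symm.proper hD' hD hε3pos
  have hEM : 0 < Real.exp (k * M) - 1 := by
    have : (0:ℝ) < k * M := by positivity
    linarith [Real.add_one_lt_exp this.ne']
  set c := m / (Real.exp (k * M) - 1) with hc
  have hc0 : 0 < c := by positivity
  have hcm : c * (Real.exp (k * M) - 1) = m := by rw [hc]; field_simp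
  set φ : E → ℝ := fun y => 1 - Real.exp (-k * ρ' y) with hφ
  have hcontw : ∀ y ∈ D', ContDiffAt ℝ 2 (fun y => ρ (g y)) y := fun y hy =>
    ((hD.smooth _ (hD.subD (h.mg hy))).comp y (h.sg y hy)).of_le two_le_infty
  have hcontφ : ∀ y ∈ U', ContDiffAt ℝ 2 φ y := fun y hy => by
    have := (hD'.smooth y hy).of_le (m := 2) two_le_infty
    exact contDiffAt_const.sub ((contDiffAt_const.mul this).exp)
  set w : E → ℝ := fun y => ρ (g y) + (-c) * φ y with hw
  have hwc : ∀ y ∈ D', ContDiffAt ℝ 2 w y := fun y hy =>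
    (hcontw y hy).add (contDiffAt_const.mul (hcontφ y (hD'.subD hy)))
  have hinner : ∀ y ∈ D', ρ' y ≤ -ε3 → w y ≤ 0 := by
    intro y hy hle
    have h1 := hp2 y hy hle
    have h2 : Real.exp (-k * ρ' y) ≤ Real.exp (k * M) := by
      apply Real.exp_le_exp.2
      have := hMb y (subset_closure hy)
      nlinarith
    simp only [hw, hφ]
    nlinarith
  have hmain : ∀ y ∈ D', w y ≤ 0 := by
    by_contra hcon
    push Not at hcon
    obtain ⟨y1, hy1, hpos⟩ := hcon
    set η := w y1 with hη
    -- points with `w ≥ η` stay away from the boundary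
    obtain ⟨a, ha, hfar⟩ : ∃ a > 0, ∀ y ∈ D', η ≤ w y → ρ' y ≤ -a := by
      refine ⟨Real.log (1 + η / c) / k, ?_, fun y hy hle => ?_⟩
      · have : 0 < η / c := by positivity
        have := Real.log_pos (x := 1 + η / c) (by linarith)
        positivity
      · have h1 := hD.neg (h.mg hy)
        simp only [hw, hφ] at hle
        have h2 : η ≤ c * (Real.exp (-k * ρ' y) - 1) := by linarith
        have h3 : 1 + η / c ≤ Real.exp (-k * ρ' y) := by
          have : η / c ≤ Real.exp (-k * ρ' y) - 1 := by
            rw [div_le_iff₀ hc0]; linarith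
          linarith
        have h4 := (Real.log_le_iff_le_exp (by positivity)).2 h3
        have h5 : Real.log (1 + η / c) / k ≤ -ρ' y := by
          rw [div_le_iff₀ hk]; linarith
        linarith
    have hK := hD'.compact_sub ha
    obtain ⟨y0, ⟨hy0, hy0a⟩, hmax⟩ := hK.exists_isMaxOn (f := w) ⟨y1, hy1, hfar y1 hy1 le_rfl⟩
      (fun y hy => (hwc y hy.1).continuousAt.continuousWithinAt)
    have hge : ∀ y ∈ D', w y ≤ w y0 := by
      intro y hy
      by_cases hle : η ≤ w y
      · exact hmax ⟨hy, hfar y hy hle⟩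
      · exact (not_le.1 hle).le.trans (hmax (a := y1) ⟨hy1, hfar y1 hy1 le_rfl⟩)
    have hlm : IsLocalMax w y0 := by
      filter_upwards [hD'.openD.mem_nhds hy0] with y hy using hge y hy
    have hη0 : 0 < w y0 := hpos.trans_le (hge y1 hy1)
    have hcol : -ε3 < ρ' y0 := by
      by_contra hcon
      linarith [hinner y0 hy0 (not_lt.1 hcon)]
    obtain ⟨v, hv⟩ := hbar y0 hy0 (by linarith)
    have hU := hD'.subD hy0
    have hJd := (hD'.smoothJ y0 hU).differentiableAt (by simp)
    have h1 := lev_max (hwc y0 hy0) hJd (hD'.sq y0 hU) hlm v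
    have h2 : lev J' w y0 v = _ := lev_comb (hcontw y0 hy0) (hcontφ y0 hU) hJd (-c) v
    have hgD := h.mg hy0
    have h3 := lev_pullback (J := J') (J' := J) (u := ρ) (f := g) (p := y0)
      ((hD.smooth _ (hD.subD hgD)).of_le two_le_infty)
      ((h.sg y0 hy0).of_le two_le_infty)
      ((hD.smoothJ _ (hD.subD hgD)).differentiableAt (by simp))
      (by filter_upwards [hD'.openD.mem_nhds hy0] with y hy using h.hg y hy) v
    have h4 : -ε < ρ (g y0) := by
      by_contra hcon
      have := hp1 (g y0) hgD (not_lt.1 hcon)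
      rw [h.fg y0 hy0] at this
      linarith
    have h5 := hL (g y0) hgD h4 (fderiv ℝ g y0 v)
    have h6 : 0 ≤ cL * ‖fderiv ℝ g y0 v‖ ^ 2 := by positivity
    have h7 : lev J' φ y0 v < 0 := hv
    nlinarith
  refine ⟨c * k, by positivity, fun y hy => ?_⟩
  have h1 := hmain y hy
  simp only [hw, hφ] at h1
  have h2 := Real.add_one_le_exp (-k * ρ' y)
  nlinarith

end Hopf

section GradEst

variable {E : Type*} [NormedAddCommGroup E] [NormedSpace ℝ E]

theorem Ctl.mono {J : E → E →L[ℝ] E} {C C' : ℝ} {p z : E} (h : Ctl J C p z) (hC : C ≤ C') :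
    Ctl J C' p z :=
  { one_le := h.one_le.trans hC
    diff := h.diff
    sq := h.sq
    nz := h.nz.trans hC
    np := h.np.trans hC
    nd := h.nd.trans hC
    lip := h.lip.trans (by gcongr) }

/-- An inner product, as a bilinear map. -/
structure IsInner (b : E →L[ℝ] E →L[ℝ] ℝ) : Prop where
  self : ∀ v, b v v = ‖v‖ ^ 2
  symm : ∀ u v, b u v = b v u
  cs : ∀ u v, |b u v| ≤ ‖u‖ * ‖v‖

theorem IsInner.adapted {b : E →L[ℝ] E →L[ℝ] ℝ} (hb : IsInner b) {Jp : E →L[ℝ] E} {C : ℝ}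
    (hsq : ∀ v, Jp (Jp v) = -v) (hC : ‖Jp‖ ≤ C) :
    Adapted (b + b.bilinearComp Jp Jp) Jp (1 + C ^ 2) := by
  have hC0 : 0 ≤ C := (norm_nonneg _).trans hC
  refine
  { one_le := by nlinarith
    symm := fun u v => ?_
    lower := fun v => ?_
    upper := fun u v => ?_
    sq := hsq
    inv := fun u v => ?_ }
  · simp [hb.symm u v, hb.symm (Jp u) (Jp v)]
  · simp [hb.self]
  · simp only [ContinuousLinearMap.add_apply, ContinuousLinearMap.bilinearComp_apply]
    have h1 := hb.cs u v
    have h2 := hb.cs (Jp u) (Jp v)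
    have h3 : ‖Jp u‖ * ‖Jp v‖ ≤ (C * ‖u‖) * (C * ‖v‖) := by
      gcongr
      · exact (Jp.le_opNorm u).trans (by gcongr)
      · exact (Jp.le_opNorm v).trans (by gcongr)
    have h4 := abs_add_le (b u v) (b (Jp u) (Jp v))
    linarith
  · simp [hsq]
    ring

variable [ProperSpace E]
variable {J J' : E → E →L[ℝ] E} {D D' U U' : Set E} {ρ ρ' : E → ℝ} {f g : E → E}

theorem grad_est {b : E →L[ℝ] E →L[ℝ] ℝ} (hb : IsInner b)
    (h : Bih J J' D D' f g) (hD : Dom J D ρ U) (hD' : Dom J' D' ρ' U') :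
    ∃ ε > 0, ∃ A > 0, ∀ x ∈ D, -ε < ρ x → ‖fderiv ℝ f x‖ ≤ A / √(-ρ x) := by
  obtain ⟨c, hc, hhopf⟩ := hopf h hD hD'
  obtain ⟨ε1, hε1, cL, hcL, hL⟩ := hD'.levi_pos
  obtain ⟨c1, hc1, hc11, hball⟩ := hD.ball_sub
  obtain ⟨Ca, hCa⟩ := hD.ctl
  obtain ⟨Cb, hCb⟩ := hD'.ctl
  obtain ⟨S, hS⟩ := hD'.bdd.subset_closedBall 0
  set C := max 1 (max Ca Cb) with hC
  have hC1 : 1 ≤ C := le_max_left _ _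
  have hCaC : Ca ≤ C := (le_max_left _ _).trans (le_max_right _ _)
  have hCbC : Cb ≤ C := (le_max_right _ _).trans (le_max_right _ _)
  set B := 1 + C ^ 2 with hB
  have hB0 : 0 < B := by positivity
  set k := 8 * B ^ 2 * C ^ 2 with hk
  have hk0 : 0 < k := by positivity
  set M0 := 2 / c with hM0
  set T := 2 * k * B * (B * (2 * S)) + 2 * B
      + (4 * B + k * (2 * S) + 2 * k ^ 2 * B) * M0 / cL with hT
  refine ⟨min (min 1 (1 / (2 * k))) (ε1 * c / 2), by positivity, √(2 * Real.exp T * B) / c1,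
    by positivity, fun x hx hlt => ?_⟩
  set δ := -ρ x with hδ
  have hδ0 : 0 < δ := by have := hD.neg hx; linarith
  have hlt' : δ < min (min 1 (1 / (2 * k))) (ε1 * c / 2) := by linarith
  have hδ1 : δ < 1 := hlt'.trans_le ((min_le_left _ _).trans (min_le_left _ _))
  have hδ2 : δ < 1 / (2 * k) := hlt'.trans_le ((min_le_left _ _).trans (min_le_right _ _))
  have hδ3 : δ < ε1 * c / 2 := hlt'.trans_le (min_le_right _ _)
  have hin : ∀ y ∈ closedBall x (c1 * δ), y ∈ D ∧ -ρ y ≤ 2 * δ := fun y hy =>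
    hball x hx y (by rwa [mem_closedBall, dist_eq_norm] at hy)
  have hlow : ∀ y ∈ closedBall x (c1 * δ), -ρ' (f y) ≤ M0 * δ := by
    intro y hy
    obtain ⟨h1, h2⟩ := hin y hy
    have h3 := hhopf (f y) (h.mf h1)
    rw [h.gf y h1] at h3
    rw [hM0, div_mul_eq_mul_div, le_div_iff₀ hc]
    linarith
  have hctl := fun y hy => (hCa x (subset_closure hx) y (subset_closure (hin y hy).1)).mono hCaC
  have hctl' := fun y hy => (hCb (f x) (subset_closure (h.mf hx)) (f y)
    (subset_closure (h.mf (hin y hy).1))).mono hCbC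
  have hxm : x ∈ closedBall x (c1 * δ) := mem_closedBall_self (by positivity)
  have key := grad_core (J := J) (J' := J') (f := f) (ρ' := ρ') (x := x) (r := c1 * δ) (B := B)
    (C := C) (S := 2 * S) (δ := δ) (cL := cL) (M0 := M0) (by positivity) hδ0 hδ1.le hcL
    (hb.adapted (hctl x hxm).sq (hctl x hxm).nz) (hb.adapted (hctl' x hxm).sq (hctl' x hxm).nz)
    hctl hctl' (by
      have h1 : k * (c1 * δ) ≤ k * (1 * (1 / (2 * k))) := by gcongr
      have h2 : k * (1 * (1 / (2 * k))) = 1 / 2 := by field_simp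
      linarith)
    (fun y hy => (h.sf y (hin y hy).1).of_le two_le_infty)
    (fun y hy => by
      filter_upwards [hD.openD.mem_nhds (hin y hy).1] with z hz using h.hf z hz)
    (fun y hy he => by rw [← h.gf y (hin y hy).1, he, h.gf x hx])
    (fun y hy => (hD'.smooth _ (hD'.subD (h.mf (hin y hy).1))).of_le two_le_infty)
    (fun y hy => (hD'.neg (h.mf (hin y hy).1)).le)
    hlow
    (fun y hy => hL _ (h.mf (hin y hy).1) (by
      have h1 := hlow y hy
      have h2 : M0 * δ < ε1 := by
        rw [hM0, div_mul_eq_mul_div, div_lt_iff₀ hc]; linarith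
      linarith))
    (fun y hy => by
      have h1 := hS (h.mf (hin y hy).1)
      have h2 := hS (h.mf hx)
      rw [mem_closedBall_zero_iff] at h1 h2
      have := norm_sub_le (f y) (f x)
      linarith)
  refine key.trans (le_of_eq ?_)
  have h1 : 2 * δ * Real.exp T * B = (2 * Real.exp T * B) * δ := by ring
  rw [← hk, ← hT, h1, Real.sqrt_mul (by positivity)]
  have h2 : √δ * √δ = δ := Real.mul_self_sqrt hδ0.le
  have h3 : 0 < √δ := Real.sqrt_pos.2 hδ0
  rw [div_div, div_eq_div_iff (by positivity) (by positivity)]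
  linear_combination (√(2 * Real.exp T * B) * c1) * h2

end GradEst

section LocalHolder

theorem vert {F : Type*} [NormedAddCommGroup F] [NormedSpace ℝ F] {γ γ' : ℝ → F} {T δ K : ℝ}
    (hT : 0 ≤ T) (hδ : 0 < δ) (hK : 0 ≤ K) (hγ : ∀ t ∈ Icc 0 T, HasDerivAt γ (γ' t) t)
    (hb : ∀ t ∈ Icc 0 T, ‖γ' t‖ ≤ K / √(δ + t / 2)) : ‖γ T - γ 0‖ ≤ 4 * K * √(T / 2) := by
  have hd : ∀ t ∈ Icc 0 T, HasDerivAt (fun t => 4 * K * (√(δ + t / 2) - √δ))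
      (K / √(δ + t / 2)) t := by
    intro t ht
    have h0 : 0 < δ + t / 2 := by linarith [ht.1]
    have h1 : HasDerivAt (fun t : ℝ => δ + t / 2) (1 / 2) t :=
      ((hasDerivAt_id t).div_const 2).const_add δ
    have h2 := ((h1.sqrt h0.ne').sub_const (√δ)).const_mul (4 * K)
    refine h2.congr_deriv ?_
    have := Real.sqrt_pos.2 h0
    field_simp
    ring
  have key := image_norm_le_of_norm_deriv_right_le_deriv_boundary' (f := fun t => γ t - γ 0)
    (f' := γ') (a := 0) (b := T) (B := fun t => 4 * K * (√(δ + t / 2) - √δ))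
    (B' := fun t => K / √(δ + t / 2))
    (fun t ht => ((hγ t ht).sub_const _).continuousAt.continuousWithinAt)
    (fun t ht => ((hγ t ⟨ht.1, ht.2.le⟩).sub_const _).hasDerivWithinAt) (by simp)
    (fun t ht => (hd t ht).continuousAt.continuousWithinAt)
    (fun t ht => (hd t ⟨ht.1, ht.2.le⟩).hasDerivWithinAt)
    (fun t ht => hb t ⟨ht.1, ht.2.le⟩) (x := T) ⟨hT, le_rfl⟩
  refine key.trans ?_
  have h1 : √(δ + T / 2) ≤ √δ + √(T / 2) := by
    have a1 := Real.sqrt_nonneg δ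
    have a2 := Real.sqrt_nonneg (T / 2)
    have a3 := Real.sq_sqrt hδ.le
    have a4 := Real.sq_sqrt (x := T / 2) (by positivity)
    exact Real.sqrt_le_iff.2 ⟨by positivity, by nlinarith⟩
  have h2 : √(δ + T / 2) - √δ ≤ √(T / 2) := by linarith
  gcongr

variable {E : Type*} [NormedAddCommGroup E] [NormedSpace ℝ E] [ProperSpace E]
variable {J : E → E →L[ℝ] E} {D U : Set E} {ρ : E → ℝ} {f : E → E}

theorem vert_dom {x ν : E} {T N A ε : ℝ} (hD : Dom J D ρ U)
    (hf : ∀ x ∈ D, DifferentiableAt ℝ f x) (hA : 0 ≤ A)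
    (hgr : ∀ x ∈ D, -ε < ρ x → ‖fderiv ℝ f x‖ ≤ A / √(-ρ x)) (hx : x ∈ D) (hT : 0 ≤ T)
    (hN : ‖ν‖ ≤ N)
    (hU : ∀ t ∈ Icc 0 T, x + t • ν ∈ U) (hν : ∀ t ∈ Icc 0 T, fderiv ℝ ρ (x + t • ν) ν ≤ -(1 / 2))
    (hε : ∀ t ∈ Icc 0 T, -ε < ρ (x + t • ν)) :
    ρ (x + T • ν) ≤ -(T / 2) ∧ ‖f (x + T • ν) - f x‖ ≤ 4 * (A * N) * √(T / 2) := by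
  have hl : ∀ t : ℝ, HasDerivAt (fun t : ℝ => x + t • ν) ν t := fun t => by
    simpa using ((hasDerivAt_id t).smul_const ν).const_add x
  have hu : ∀ t ∈ Icc 0 T, HasDerivAt (fun t => ρ (x + t • ν)) (fderiv ℝ ρ (x + t • ν) ν) t :=
    fun t ht => ((hD.smooth _ (hU t ht)).differentiableAt (by simp)).hasFDerivAt.comp_hasDerivAt t
      (hl t)
  have hle : ∀ t ∈ Icc 0 T, ρ (x + t • ν) ≤ ρ x - t / 2 := by
    intro t ht
    refine image_le_of_deriv_right_le_deriv_boundary (f := fun t => ρ (x + t • ν))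
      (f' := fun t => fderiv ℝ ρ (x + t • ν) ν) (a := 0) (b := T)
      (B := fun t => ρ x - t / 2) (B' := fun _ => -(1 / 2))
      (fun t ht => (hu t ht).continuousAt.continuousWithinAt)
      (fun t ht => (hu t ⟨ht.1, ht.2.le⟩).hasDerivWithinAt) (by simp)
      (by fun_prop)
      (fun t _ => ?_)
      (fun t ht => hν t ⟨ht.1, ht.2.le⟩) ht
    exact (((hasDerivAt_id t).div_const 2).const_sub (ρ x)).hasDerivWithinAt
  have hx0 := hD.neg hx
  have hin : ∀ t ∈ Icc 0 T, x + t • ν ∈ D := fun t ht =>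
    (hD.eq _).2 ⟨hU t ht, by linarith [hle t ht, ht.1]⟩
  refine ⟨by linarith [hle T ⟨hT, le_rfl⟩], ?_⟩
  have hN0 : 0 ≤ N := (norm_nonneg _).trans hN
  have := vert (γ := fun t => f (x + t • ν)) (γ' := fun t => fderiv ℝ f (x + t • ν) ν)
    (T := T) (δ := -ρ x) (K := A * N) hT (by linarith) (by positivity)
    (fun t ht => ((hf _ (hin t ht)).hasFDerivAt).comp_hasDerivAt t (hl t)) (fun t ht => by
      have h1 := hgr _ (hin t ht) (hε t ht)
      have h2 := hle t ht
      calc ‖fderiv ℝ f (x + t • ν) ν‖ ≤ ‖fderiv ℝ f (x + t • ν)‖ * ‖ν‖ :=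
            ContinuousLinearMap.le_opNorm _ _
        _ ≤ (A / √(-ρ (x + t • ν))) * N := by gcongr
        _ ≤ (A / √(-ρ x + t / 2)) * N := by
            have : 0 < √(-ρ x + t / 2) := Real.sqrt_pos.2 (by linarith [ht.1])
            gcongr
            linarith
        _ = A * N / √(-ρ x + t / 2) := by ring)
  simpa using this

theorem local_holder_frontier {A ε : ℝ} (hD : Dom J D ρ U)
    (hf : ∀ x ∈ D, DifferentiableAt ℝ f x) (hA : 0 ≤ A) (hε : 0 < ε)
    (hgr : ∀ x ∈ D, -ε < ρ x → ‖fderiv ℝ f x‖ ≤ A / √(-ρ x)) {x0 : E} (hx0 : x0 ∈ frontier D) :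
    ∃ V ∈ 𝓝 x0, ∃ C, ∀ x ∈ V, ∀ y ∈ V, x ∈ D → y ∈ D → ‖f x - f y‖ ≤ C * √‖x - y‖ := by
  have hx0U : x0 ∈ U := hD.sub (frontier_subset_closure hx0)
  obtain ⟨ν, hν⟩ : ∃ ν, fderiv ℝ ρ x0 ν = -1 := by
    obtain ⟨w, hw⟩ : ∃ w, fderiv ℝ ρ x0 w ≠ 0 := by
      by_contra hcon
      push Not at hcon
      exact hD.grad x0 hx0 (ContinuousLinearMap.ext hcon)
    exact ⟨(-(fderiv ℝ ρ x0 w)⁻¹) • w, by simp [hw]⟩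
  set L := ‖fderiv ℝ ρ x0‖ + 1 with hL
  have hL1 : 1 ≤ L := by have := norm_nonneg (fderiv ℝ ρ x0); linarith
  set N := ‖ν‖ with hN
  have hN0 : 0 ≤ N := norm_nonneg _
  have hcd : ContinuousAt (fderiv ℝ ρ) x0 :=
    ((hD.smooth x0 hx0U).fderiv_right (m := (⊤ : ℕ∞)) (by simp)).continuousAt
  have e1 : ∀ᶠ z in 𝓝 x0, z ∈ U := hD.openU.mem_nhds hx0U
  have e2 : ∀ᶠ z in 𝓝 x0, fderiv ℝ ρ z ν < -(1 / 2) := by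
    have : ContinuousAt (fun z => fderiv ℝ ρ z ν) x0 := hcd.clm_apply continuousAt_const
    exact this.eventually_lt_const (by simp only [hν]; norm_num)
  have e3 : ∀ᶠ z in 𝓝 x0, ‖fderiv ℝ ρ z‖ < L := hcd.norm.eventually_lt_const (by linarith)
  have e4 : ∀ᶠ z in 𝓝 x0, -ε < ρ z :=
    (hD.smooth x0 hx0U).continuousAt.eventually_const_lt (by rw [hD.frontier_zero hx0]; linarith)
  obtain ⟨R, hR, hball⟩ := Metric.eventually_nhds_iff_ball.1 (e1.and (e2.and (e3.and e4)))
  set R' := R / (2 + 8 * L * N) with hR'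
  have hR'0 : 0 < R' := by positivity
  have hR'e : R' * (2 + 8 * L * N) = R := by rw [hR']; field_simp
  refine ⟨ball x0 R', ball_mem_nhds _ hR'0, 8 * (A * N) * √(2 * L) + A, fun x hx y hy hxD hyD => ?_⟩
  set d := ‖x - y‖ with hd
  rcases eq_or_ne x y with hxy | hxy
  · simp [hd, hxy]
  have hd0 : 0 < d := norm_pos_iff.2 (sub_ne_zero.2 hxy)
  have hd2 : d < 2 * R' := by
    rw [mem_ball, dist_eq_norm] at hx hy
    have : x - y = (x - x0) - (y - x0) := by abel
    rw [hd, this]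
    linarith [norm_sub_le (x - x0) (y - x0)]
  set T := 4 * L * d with hT
  have hT0 : 0 ≤ T := by positivity
  have hin : ∀ z ∈ ball x0 R', ∀ t ∈ Icc 0 T, z + t • ν ∈ ball x0 R := by
    intro z hz t ht
    rw [mem_ball, dist_eq_norm] at hz ⊢
    have h1 : z + t • ν - x0 = (z - x0) + t • ν := by abel
    rw [h1]
    have h2 : ‖t • ν‖ ≤ T * N := by
      rw [norm_smul, Real.norm_eq_abs, abs_of_nonneg ht.1]
      exact mul_le_mul_of_nonneg_right ht.2 hN0
    have h3 : T * N ≤ 4 * L * (2 * R') * N := by rw [hT]; gcongr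
    nlinarith [norm_add_le (z - x0) (t • ν)]
  have hTm : T ∈ Icc 0 T := ⟨hT0, le_rfl⟩
  obtain ⟨vx1, vx2⟩ := vert_dom hD hf hA hgr hxD hT0 (le_refl N)
    (fun t ht => (hball _ (hin x hx t ht)).1) (fun t ht => (hball _ (hin x hx t ht)).2.1.le)
    (fun t ht => (hball _ (hin x hx t ht)).2.2.2)
  obtain ⟨vy1, vy2⟩ := vert_dom hD hf hA hgr hyD hT0 (le_refl N)
    (fun t ht => (hball _ (hin y hy t ht)).1) (fun t ht => (hball _ (hin y hy t ht)).2.1.le)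
    (fun t ht => (hball _ (hin y hy t ht)).2.2.2)
  set X := x + T • ν with hX
  set Y := y + T • ν with hY
  have hXY : X - Y = x - y := by rw [hX, hY]; abel
  have hXb := hin x hx T hTm
  have hYb := hin y hy T hTm
  have hseg : segment ℝ Y X ⊆ ball x0 R := (convex_ball x0 R).segment_subset hYb hXb
  have hsρ : ∀ z ∈ segment ℝ Y X, ρ z ≤ -(L * d) := by
    intro z hz
    have h1 := (convex_ball x0 R).norm_image_sub_le_of_norm_fderiv_le (𝕜 := ℝ) (f := ρ) (C := L)
      (fun z hz => (hD.smooth z (hball z hz).1).differentiableAt (by simp))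
      (fun z hz => (hball z hz).2.2.1.le) hYb (hseg hz)
    have h2 : ‖z - Y‖ ≤ d := by
      have := norm_sub_le_of_mem_segment hz
      rwa [hXY] at this
    have h3 : L * ‖z - Y‖ ≤ L * d := by gcongr
    have h4 := (le_abs_self _).trans h1
    linarith
  have hsD : ∀ z ∈ segment ℝ Y X, z ∈ D := fun z hz =>
    (hD.eq z).2 ⟨(hball z (hseg hz)).1, by
      have := hsρ z hz
      have : 0 < L * d := by positivity
      linarith⟩
  have hor := (convex_segment (𝕜 := ℝ) Y X).norm_image_sub_le_of_norm_fderiv_le (𝕜 := ℝ) (f := f)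
      (C := A / √d) (fun z hz => hf z (hsD z hz)) (fun z hz => by
        refine (hgr z (hsD z hz) (hball z (hseg hz)).2.2.2).trans ?_
        have h1 := hsρ z hz
        have h2 : d ≤ -ρ z := by nlinarith
        have : 0 < √d := Real.sqrt_pos.2 hd0
        gcongr) (left_mem_segment ℝ Y X) (right_mem_segment ℝ Y X)
  rw [hXY] at hor
  have h1 : A / √d * d = A * √d := by
    have h2 : √d * √d = d := Real.mul_self_sqrt hd0.le
    have h3 : 0 < √d := Real.sqrt_pos.2 hd0
    field_simp
    linear_combination (-A) * h2
  have h2 : √(T / 2) = √(2 * L) * √d := by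
    rw [← Real.sqrt_mul (by positivity)]
    congr 1
    rw [hT]; ring
  rw [h2] at vx2 vy2
  have h3 : f x - f y = -(f X - f x) + (f X - f Y) + (f Y - f y) := by abel
  calc ‖f x - f y‖ ≤ ‖f X - f x‖ + ‖f X - f Y‖ + ‖f Y - f y‖ := by
        rw [h3]
        refine (norm_add₃_le).trans ?_
        rw [norm_neg]
    _ ≤ (8 * (A * N) * √(2 * L) + A) * √d := by
        have h4 : ‖f X - f Y‖ ≤ A * √d := by rw [← h1]; exact hor
        linarith

end LocalHolder

section GlobalHolder

theorem holderOnWith_of_sqrt {X : Type*} [NormedAddCommGroup X] {F : X → X} {S : Set X} {C : ℝ}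
    (h : ∀ x ∈ S, ∀ y ∈ S, ‖F x - F y‖ ≤ C * √‖x - y‖) :
    ∃ C : NNReal, HolderOnWith C (1 / 2 : NNReal) F S := by
  refine ⟨C.toNNReal, fun x hx y hy => ?_⟩
  have h1 := h x hx y hy
  have h2 : ‖F x - F y‖ ≤ C.toNNReal * ‖x - y‖ ^ (1 / 2 : ℝ) := by
    rw [← Real.sqrt_eq_rpow]
    exact h1.trans (by gcongr; exact Real.le_coe_toNNReal C)
  rw [edist_dist, edist_dist, dist_eq_norm, dist_eq_norm]
  have h3 : ((1 / 2 : NNReal) : ℝ) = 1 / 2 := by simp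
  rw [h3, ENNReal.ofReal_rpow_of_nonneg (norm_nonneg _) (by norm_num)]
  have h4 : (C.toNNReal : ENNReal) = ENNReal.ofReal (C.toNNReal : ℝ) :=
    (ENNReal.ofReal_coe_nnreal).symm
  rw [h4, ← ENNReal.ofReal_mul (NNReal.coe_nonneg _)]
  exact ENNReal.ofReal_le_ofReal h2

variable {E : Type*} [NormedAddCommGroup E] [NormedSpace ℝ E]

/-- A square-root Hölder map extends to the closure. -/
theorem extend_sqrt [CompleteSpace E] {D : Set E} {f : E → E} {C : ℝ}
    (h : ∀ x ∈ D, ∀ y ∈ D, ‖f x - f y‖ ≤ C * √‖x - y‖) :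
    ∃ F : E → E, (∀ x ∈ D, F x = f x) ∧ ContinuousOn F (closure D) ∧
      (∃ C : NNReal, HolderOnWith C (1 / 2 : NNReal) F (closure D)) := by
  obtain ⟨C', hC'⟩ := holderOnWith_of_sqrt h
  have hu : UniformContinuousOn f D := hC'.uniformContinuousOn (by norm_num)
  have hlim : ∀ x ∈ closure D, ∃ y, Tendsto f (𝓝[D] x) (𝓝 y) := by
    intro x hx
    haveI := mem_closure_iff_nhdsWithin_neBot.mp hx
    have h1 : Cauchy (𝓝[D] x) := cauchy_nhds.mono nhdsWithin_le_nhds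
    exact cauchy_map_iff_exists_tendsto.1 (h1.map_of_le hu (le_principal_iff.2 self_mem_nhdsWithin))
  refine ⟨extendFrom D f, extendFrom_extends hu.continuousOn,
    continuousOn_extendFrom subset_rfl hlim, holderOnWith_of_sqrt (C := C) ?_⟩
  intro x hx y hy
  haveI := mem_closure_iff_nhdsWithin_neBot.mp hx
  haveI := mem_closure_iff_nhdsWithin_neBot.mp hy
  have a1 : Tendsto (fun q : E × E => q.1) (𝓝[D] x ×ˢ 𝓝[D] y) (𝓝 x) :=
    (tendsto_id.mono_left nhdsWithin_le_nhds).comp tendsto_fst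
  have a2 : Tendsto (fun q : E × E => q.2) (𝓝[D] x ×ˢ 𝓝[D] y) (𝓝 y) :=
    (tendsto_id.mono_left nhdsWithin_le_nhds).comp tendsto_snd
  have b1 : Tendsto (fun q : E × E => f q.1) (𝓝[D] x ×ˢ 𝓝[D] y) (𝓝 (extendFrom D f x)) :=
    (tendsto_extendFrom (hlim x hx)).comp tendsto_fst
  have b2 : Tendsto (fun q : E × E => f q.2) (𝓝[D] x ×ˢ 𝓝[D] y) (𝓝 (extendFrom D f y)) :=
    (tendsto_extendFrom (hlim y hy)).comp tendsto_snd
  refine le_of_tendsto_of_tendsto (b1.sub b2).norm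
    ((Real.continuous_sqrt.continuousAt.tendsto.comp (a1.sub a2).norm).const_mul C) ?_
  filter_upwards [prod_mem_prod (self_mem_nhdsWithin (s := D) (a := x))
    (self_mem_nhdsWithin (s := D) (a := y))] with q hq
  exact h q.1 hq.1 q.2 hq.2

variable [ProperSpace E]
variable {J J' : E → E →L[ℝ] E} {D D' U U' : Set E} {ρ ρ' : E → ℝ} {f g : E → E}

theorem global_sqrt {b : E →L[ℝ] E →L[ℝ] ℝ} (hb : IsInner b)
    (h : Bih J J' D D' f g) (hD : Dom J D ρ U) (hD' : Dom J' D' ρ' U') :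
    ∃ C, ∀ x ∈ D, ∀ y ∈ D, ‖f x - f y‖ ≤ C * √‖x - y‖ := by
  obtain ⟨ε, hε, A, hA, hgr⟩ := grad_est hb h hD hD'
  have hloc : ∀ x0 ∈ closure D, ∃ V ∈ 𝓝 x0, ∃ C, ∀ x ∈ V, ∀ y ∈ V, x ∈ D → y ∈ D →
      ‖f x - f y‖ ≤ C * √‖x - y‖ := by
    intro x0 hx0
    by_cases hx0D : x0 ∈ D
    · obtain ⟨K, t, ht, hK⟩ := ((h.sf x0 hx0D).of_le (m := 1) (by simp)).exists_lipschitzOnWith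
      refine ⟨t ∩ ball x0 (1 / 2), inter_mem ht (ball_mem_nhds _ (by norm_num)), K,
        fun x hx y hy _ _ => ?_⟩
      refine (hK.norm_sub_le hx.1 hy.1).trans ?_
      gcongr
      have hd : ‖x - y‖ ≤ 1 := by
        have h1 := hx.2
        have h2 := hy.2
        rw [mem_ball] at h1 h2
        rw [← dist_eq_norm]
        linarith [dist_triangle_right x y x0]
      apply Real.le_sqrt_of_sq_le
      nlinarith [norm_nonneg (x - y)]
    · exact local_holder_frontier hD (fun x hx => (h.sf x hx).differentiableAt (by simp)) hA.le hε
        hgr (by rw [hD.openD.frontier_eq]; exact ⟨hx0, hx0D⟩)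
  obtain ⟨S, hS⟩ := hD'.bdd.subset_closedBall 0
  have hSb : ∀ x ∈ D, ‖f x‖ ≤ |S| := fun x hx => by
    have := hS (h.mf hx)
    rw [mem_closedBall_zero_iff] at this
    exact this.trans (le_abs_self S)
  have key : ∃ C, ∀ q ∈ closure D ×ˢ closure D, q.1 ∈ D → q.2 ∈ D →
      ‖f q.1 - f q.2‖ ≤ C * √‖q.1 - q.2‖ := by
    refine IsCompact.induction_on
      (p := fun s : Set (E × E) => ∃ C, ∀ q ∈ s, q.1 ∈ D → q.2 ∈ D →
        ‖f q.1 - f q.2‖ ≤ C * √‖q.1 - q.2‖) (hD.compact.prod hD.compact) ?_ ?_ ?_ ?_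
    · exact ⟨0, fun q hq => absurd hq (notMem_empty _)⟩
    · rintro s t hst ⟨C, hC⟩
      exact ⟨C, fun q hq => hC q (hst hq)⟩
    · rintro s t ⟨C, hC⟩ ⟨C', hC'⟩
      refine ⟨max C C', fun q hq h1 h2 => ?_⟩
      rcases hq with hq | hq
      · exact (hC q hq h1 h2).trans (by gcongr; exact le_max_left _ _)
      · exact (hC' q hq h1 h2).trans (by gcongr; exact le_max_right _ _)
    · rintro ⟨x0, y0⟩ ⟨hx0, hy0⟩
      by_cases hxy : x0 = y0
      · subst hxy
        obtain ⟨V, hV, C, hC⟩ := hloc x0 hx0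
        exact ⟨V ×ˢ V, mem_nhdsWithin_of_mem_nhds (prod_mem_nhds hV hV), C,
          fun q hq h1 h2 => hC q.1 hq.1 q.2 hq.2 h1 h2⟩
      · set r := ‖x0 - y0‖ with hr
        have hr0 : 0 < r := norm_pos_iff.2 (sub_ne_zero.2 hxy)
        have hcont : Continuous fun q : E × E => ‖q.1 - q.2‖ := by fun_prop
        refine ⟨{q | r / 2 < ‖q.1 - q.2‖}, mem_nhdsWithin_of_mem_nhds
          ((isOpen_lt continuous_const hcont).mem_nhds (by
            simp only [mem_ofPred_eq]; linarith)), 2 * |S| / √(r / 2), fun q hq h1 h2 => ?_⟩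
        have hq' : r / 2 < ‖q.1 - q.2‖ := hq
        have h3 : √(r / 2) ≤ √‖q.1 - q.2‖ := Real.sqrt_le_sqrt hq'.le
        have h4 : 0 < √(r / 2) := Real.sqrt_pos.2 (by positivity)
        have h5 := norm_sub_le (f q.1) (f q.2)
        have h6 := hSb q.1 h1
        have h7 := hSb q.2 h2
        rw [div_mul_eq_mul_div, le_div_iff₀ h4]
        exact mul_le_mul (by linarith) h3 h4.le (by positivity)
  obtain ⟨C, hC⟩ := key
  exact ⟨C, fun x hx y hy => hC (x, y) ⟨subset_closure hx, subset_closure hy⟩ hx hy⟩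

theorem main_ext {b : E →L[ℝ] E →L[ℝ] ℝ} (hb : IsInner b)
    (h : Bih J J' D D' f g) (hD : Dom J D ρ U) (hD' : Dom J' D' ρ' U') :
    ∃ F G : E → E,
      (∀ x ∈ D, F x = f x) ∧ (∀ y ∈ D', G y = g y) ∧
      ContinuousOn F (closure D) ∧ ContinuousOn G (closure D') ∧
      MapsTo F (closure D) (closure D') ∧ MapsTo G (closure D') (closure D) ∧
      (∀ x ∈ closure D, G (F x) = x) ∧ (∀ y ∈ closure D', F (G y) = y) ∧
      (∃ C : NNReal, HolderOnWith C (1 / 2 : NNReal) F (closure D)) ∧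
      (∃ C : NNReal, HolderOnWith C (1 / 2 : NNReal) G (closure D')) := by
  obtain ⟨C, hC⟩ := global_sqrt hb h hD hD'
  obtain ⟨C', hC'⟩ := global_sqrt hb h.symm hD' hD
  obtain ⟨F, hF1, hF2, hF3⟩ := extend_sqrt hC
  obtain ⟨G, hG1, hG2, hG3⟩ := extend_sqrt hC'
  have hFm : MapsTo F (closure D) (closure D') :=
    MapsTo.closure_of_continuousOn (fun x hx => by rw [hF1 x hx]; exact h.mf hx) hF2
  have hGm : MapsTo G (closure D') (closure D) :=
    MapsTo.closure_of_continuousOn (fun x hx => by rw [hG1 x hx]; exact h.mg hx) hG2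
  refine ⟨F, G, hF1, hG1, hF2, hG2, hFm, hGm, ?_, ?_, hF3, hG3⟩
  · have := EqOn.of_subset_closure (s := D) (t := closure D) (f := fun x => G (F x)) (g := id)
      (fun x hx => by simp [hF1 x hx, hG1 _ (h.mf hx), h.gf x hx])
      (hG2.comp hF2 hFm) continuousOn_id subset_closure subset_rfl
    exact this
  · have := EqOn.of_subset_closure (s := D') (t := closure D') (f := fun x => F (G x)) (g := id)
      (fun x hx => by simp [hG1 x hx, hF1 _ (h.mg hx), h.fg x hx])
      (hF2.comp hG2 hGm) continuousOn_id subset_closure subset_rfl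
    exact this

end GlobalHolder

theorem dom_of {n : ℕ} {D Ω : Set (Cn n)} (hΩ : IsOpen Ω) (hDΩ : closure D ⊆ Ω)
    {J : Cn n → Cn n →L[ℝ] Cn n} (hJ : IsACS Ω J) (hD : StrictlyPseudoconvexDomain J D) :
    ∃ ρ U, Dom J D ρ U := by
  obtain ⟨hDo, -, hDb, Ωρ, ρ, ⟨hΩρ, hsub, hsm, heq, hgrad⟩, -, W, hW, hfW, hstr⟩ := hD
  refine ⟨ρ, Ω ∩ Ωρ,
    { openU := hΩ.inter hΩρ
      openD := hDo
      bdd := hDb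
      sub := subset_inter hDΩ hsub
      smooth := fun x hx => hsm.contDiffAt (hΩρ.mem_nhds hx.2)
      smoothJ := fun x hx => hJ.1.contDiffAt (hΩ.mem_nhds hx.1)
      sq := fun x hx v => by
        have := congrArg (fun T : Cn n →L[ℝ] Cn n => T v) (hJ.2 x hx.1)
        simpa using this
      eq := fun x => ?_
      grad := hgrad
      strict := ⟨W, hW, hfW, fun x hx v hv => hstr x hx v hv⟩ }⟩
  constructor
  · intro hx
    refine ⟨⟨hDΩ (subset_closure hx), hsub (subset_closure hx)⟩, ?_⟩
    rw [heq] at hx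
    exact hx.2
  · rintro ⟨⟨-, h1⟩, h2⟩
    rw [heq]
    exact ⟨h1, h2⟩

theorem cn_inner (n : ℕ) : IsInner (innerSL ℝ : Cn n →L[ℝ] Cn n →L[ℝ] ℝ) :=
  { self := fun v => real_inner_self_eq_norm_sq v
    symm := fun u v => (real_inner_comm u v).symm
    cs := fun u v => abs_real_inner_le_norm u v }

/-- **Hölder extension of biholomorphisms** (Theorem 3.3.1): a smooth `(J,J')`-biholomorphism
between bounded strictly pseudoconvex domains with `C^∞` boundary extends to a homeomorphism
between the closures which is `1/2`-Hölder continuous in both directions. -/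
theorem biholomorphism_holder_extension {n : ℕ} (D D' : Set (Cn n))
    (Ω Ω' : Set (Cn n)) (hΩ : IsOpen Ω) (hΩ' : IsOpen Ω')
    (hDΩ : closure D ⊆ Ω) (hD'Ω' : closure D' ⊆ Ω')
    (J J' : Cn n → Cn n →L[ℝ] Cn n) (hJ : IsACS Ω J) (hJ' : IsACS Ω' J')
    (hD : StrictlyPseudoconvexDomain J D) (hD' : StrictlyPseudoconvexDomain J' D')
    (f g : Cn n → Cn n)
    (hf : ContDiffOn ℝ (⊤ : ℕ∞) f D) (hg : ContDiffOn ℝ (⊤ : ℕ∞) g D')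
    (hfD : MapsTo f D D') (hgD : MapsTo g D' D)
    (hgf : ∀ x ∈ D, g (f x) = x) (hfg : ∀ y ∈ D', f (g y) = y)
    (hfhol : PseudoHolOn J J' f D) :
    ∃ F G : Cn n → Cn n,
      (∀ x ∈ D, F x = f x) ∧ (∀ y ∈ D', G y = g y) ∧
      ContinuousOn F (closure D) ∧ ContinuousOn G (closure D') ∧
      MapsTo F (closure D) (closure D') ∧ MapsTo G (closure D') (closure D) ∧
      (∀ x ∈ closure D, G (F x) = x) ∧ (∀ y ∈ closure D', F (G y) = y) ∧
      (∃ C : NNReal, HolderOnWith C (1 / 2 : NNReal) F (closure D)) ∧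
      (∃ C : NNReal, HolderOnWith C (1 / 2 : NNReal) G (closure D')) := by
  obtain ⟨ρ, U, hDom⟩ := dom_of hΩ hDΩ hJ hD
  obtain ⟨ρ', U', hDom'⟩ := dom_of hΩ' hD'Ω' hJ' hD'
  have sf : ∀ x ∈ D, ContDiffAt ℝ (⊤ : ℕ∞) f x := fun x hx =>
    hf.contDiffAt (hDom.openD.mem_nhds hx)
  have sg : ∀ y ∈ D', ContDiffAt ℝ (⊤ : ℕ∞) g y := fun y hy =>
    hg.contDiffAt (hDom'.openD.mem_nhds hy)
  have hghol : ∀ y ∈ D', (fderiv ℝ g y).comp (J' y) = (J (g y)).comp (fderiv ℝ g y) := by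
    intro y hy
    have hdg : HasFDerivAt g (fderiv ℝ g y) y :=
      ((sg y hy).differentiableAt (by simp)).hasFDerivAt
    have hdf : HasFDerivAt f (fderiv ℝ f (g y)) (g y) :=
      ((sf _ (hgD hy)).differentiableAt (by simp)).hasFDerivAt
    have h1 : (fderiv ℝ f (g y)).comp (fderiv ℝ g y) = ContinuousLinearMap.id ℝ (Cn n) := by
      refine (hdf.comp y hdg).unique ((hasFDerivAt_id y).congr_of_eventuallyEq ?_)
      filter_upwards [hDom'.openD.mem_nhds hy] with z hz using hfg z hz
    have h2 : (fderiv ℝ g y).comp (fderiv ℝ f (g y)) = ContinuousLinearMap.id ℝ (Cn n) := by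
      have hdg' : HasFDerivAt g (fderiv ℝ g y) (f (g y)) := by rwa [hfg y hy]
      refine (hdg'.comp (g y) hdf).unique ((hasFDerivAt_id (g y)).congr_of_eventuallyEq ?_)
      filter_upwards [hDom.openD.mem_nhds (hgD hy)] with z hz using hgf z hz
    have h3 := (hfhol (g y) (hgD hy)).2
    rw [hfg y hy] at h3
    calc (fderiv ℝ g y).comp (J' y)
        = (fderiv ℝ g y).comp ((J' y).comp ((fderiv ℝ f (g y)).comp (fderiv ℝ g y))) := by
          rw [h1, ContinuousLinearMap.comp_id]
      _ = (fderiv ℝ g y).comp (((J' y).comp (fderiv ℝ f (g y))).comp (fderiv ℝ g y)) := rfl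
      _ = ((fderiv ℝ g y).comp (fderiv ℝ f (g y))).comp ((J (g y)).comp (fderiv ℝ g y)) := by
          rw [← h3]; rfl
      _ = (J (g y)).comp (fderiv ℝ g y) := by rw [h2, ContinuousLinearMap.id_comp]
  exact main_ext (cn_inner n) ⟨sf, sg, hfD, hgD, hgf, hfg, fun x hx => (hfhol x hx).2, hghol⟩
    hDom hDom'
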